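/- arXiv:2212.07732 — 6 statements merged into one kernel-verified Lean document; each statement's English description precedes it below -/
import Mathlib

section
/- For all integers c, d ≥ 2, the inequality √(c² + 4) + √(d² + 4) ≥ √(c² + d²) + √8 holds. -/
/-- For all integers `c, d ≥ 2`, `√(c² + 4) + √(d² + 4) ≥ √(c² + d²) + √8`. -/
theorem ineq1 (c d : ℤ) (hc : 2 ≤ c) (hd : 2 ≤ d) :
    Real.sqrt ((c : ℝ) ^ 2 + 4) + Real.sqrt ((d : ℝ) ^ 2 + 4) ≥
      Real.sqrt ((c : ℝ) ^ 2 + (d : ℝ) ^ 2) + Real.sqrt 8 := by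
  have hc' : (2 : ℝ) ≤ c := by exact_mod_cast hc
  have hd' : (2 : ℝ) ≤ d := by exact_mod_cast hd
  have h1 : (0 : ℝ) ≤ (c : ℝ) ^ 2 - 4 := by nlinarith
  have h2 : (0 : ℝ) ≤ (d : ℝ) ^ 2 - 4 := by nlinarith
  have key : Real.sqrt ((c : ℝ) ^ 2 + (d : ℝ) ^ 2) * Real.sqrt 8 ≤
      Real.sqrt ((c : ℝ) ^ 2 + 4) * Real.sqrt ((d : ℝ) ^ 2 + 4) := by
    rw [← Real.sqrt_mul (by positivity), ← Real.sqrt_mul (by positivity)]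
    apply Real.sqrt_le_sqrt
    nlinarith [mul_nonneg h1 h2]
  have e1 := Real.sq_sqrt (show (0 : ℝ) ≤ (c : ℝ) ^ 2 + 4 by positivity)
  have e2 := Real.sq_sqrt (show (0 : ℝ) ≤ (d : ℝ) ^ 2 + 4 by positivity)
  have e3 := Real.sq_sqrt (show (0 : ℝ) ≤ (c : ℝ) ^ 2 + (d : ℝ) ^ 2 by positivity)
  have e4 := Real.sq_sqrt (show (0 : ℝ) ≤ 8 by norm_num)
  apply abs_le_of_sq_le_sq' _ (by positivity) |>.2
  rw [add_sq, add_sq, e1, e2, e3, e4]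
  linarith
end

section
/- Let T be a finite tree and let u, v ∈ V(T) be adjacent vertices with deg(u) = m+1 and deg(v) = n+1, where m ≥ n ≥ 2, so that N(u)∖{v} = {u₁,…,u_m} and N(v)∖{u} = {v₁,…,v_n}, and assume deg(v₁) ≥ deg(v_i) for all i ≥ 2. Let T* be the tree obtained from T by deleting the edges v v_i for all 2 ≤ i ≤ n and adding the edges u v_i for all 2 ≤ i ≤ n. Then SO(T*) > SO(T). -/
open SimpleGraph

/-- The Sombor index of a finite simple graph:
`SO(G) = Σ_{uv ∈ E(G)} √(d(u)² + d(v)²)`. -/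
noncomputable def somborIndex {V : Type*} [Fintype V] (G : SimpleGraph V) : ℝ :=
  letI := Classical.decEq V
  letI : DecidableRel G.Adj := Classical.decRel _
  ∑ e ∈ G.edgeFinset,
    Sym2.lift ⟨fun a b => Real.sqrt ((G.degree a : ℝ) ^ 2 + (G.degree b : ℝ) ^ 2),
      fun a b => by simp [add_comm]⟩ e

lemma so_mono_diff (a b x y : ℝ) (hb : 0 ≤ b) (hab : b ≤ a) (hx : 0 ≤ x) (hxy : x ≤ y) :
    √(a^2+y^2) + √(b^2+x^2) ≤ √(a^2+x^2) + √(b^2+y^2) := by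
  have h1 : √(a^2+y^2) * √(b^2+x^2) ≤ √(a^2+x^2) * √(b^2+y^2) := by
    rw [← Real.sqrt_mul (by positivity), ← Real.sqrt_mul (by positivity)]
    apply Real.sqrt_le_sqrt
    have h2 : 0 ≤ a^2 - b^2 := by nlinarith
    have h3 : 0 ≤ y^2 - x^2 := by nlinarith
    nlinarith [mul_nonneg h2 h3]
  apply le_of_sq_le_sq _ (by positivity)
  have e1 := Real.sq_sqrt (show 0 ≤ a^2+y^2 by positivity)
  have e2 := Real.sq_sqrt (show 0 ≤ b^2+x^2 by positivity)
  have e3 := Real.sq_sqrt (show 0 ≤ a^2+x^2 by positivity)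
  have e4 := Real.sq_sqrt (show 0 ≤ b^2+y^2 by positivity)
  nlinarith

lemma so_convex (p q r d : ℝ) (hr : 0 ≤ r) (hp : 0 ≤ p) (hq : 0 ≤ q) (h : 2 * r ≤ p + q) :
    2 * √(r^2+d^2) ≤ √(p^2+d^2) + √(q^2+d^2) := by
  have h1 : p*q+d^2 ≤ √(p^2+d^2) * √(q^2+d^2) := by
    rw [← Real.sqrt_mul (by positivity)]
    apply Real.le_sqrt_of_sq_le
    nlinarith [sq_nonneg (p*d - q*d)]
  apply le_of_sq_le_sq _ (by positivity)
  have e1 := Real.sq_sqrt (show 0 ≤ r^2+d^2 by positivity)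
  have e2 := Real.sq_sqrt (show 0 ≤ p^2+d^2 by positivity)
  have e3 := Real.sq_sqrt (show 0 ≤ q^2+d^2 by positivity)
  have : (2*r)^2 ≤ (p+q)^2 := by gcongr
  nlinarith

/-- Edge weight for a vertex weighting. -/
noncomputable def soW {V : Type*} (d : V → ℕ) : Sym2 V → ℝ :=
  Sym2.lift ⟨fun a b => Real.sqrt ((d a : ℝ) ^ 2 + (d b : ℝ) ^ 2),
      fun a b => by simp [add_comm]⟩

lemma soW_mk {V : Type*} (d : V → ℕ) (a b : V) :
    soW d s(a,b) = √((d a : ℝ) ^ 2 + (d b : ℝ) ^ 2) := rfl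

lemma so_eq {V : Type*} [Fintype V] (G : SimpleGraph V) [DecidableRel G.Adj] [DecidableEq V] :
    somborIndex G = ∑ e ∈ G.edgeFinset, soW (fun x => G.degree x) e := by
  unfold somborIndex soW
  congr!

/-- Lemma 2.5 (tree case, adjacent branch vertices): moving all but one of the
branches of `v` over to the adjacent branch vertex `u` (with `deg u ≥ deg v`)
strictly increases the Sombor index. -/
theorem sombor_tree_shift_adjacent {V : Type*} [Fintype V]
    (T : SimpleGraph V) [DecidableRel T.Adj] (hT : T.IsTree)
    (u v : V) (huv : T.Adj u v)
    (m n : ℕ) (hn2 : 2 ≤ n) (hnm : n ≤ m)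
    (hdu : T.degree u = m + 1) (hdv : T.degree v = n + 1)
    (U : Fin m → V) (hUinj : Function.Injective U)
    (hU : T.neighborSet u \ {v} = Set.range U)
    (W : Fin n → V) (hWinj : Function.Injective W)
    (hW : T.neighborSet v \ {u} = Set.range W)
    (hmax : ∀ i : Fin n, T.degree (W i) ≤ T.degree (W ⟨0, by omega⟩))
    (T' : SimpleGraph V)
    (hT' : T'.edgeSet =
      (T.edgeSet \ {e | ∃ i : Fin n, (i : ℕ) ≠ 0 ∧ e = s(v, W i)}) ∪
        {e | ∃ i : Fin n, (i : ℕ) ≠ 0 ∧ e = s(u, W i)}) :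
    somborIndex T < somborIndex T' := by
  classical
  have hn0 : 0 < n := by omega
  set i0 : Fin n := ⟨0, hn0⟩ with hi0
  have hne0 : ∀ i : Fin n, (i : ℕ) ≠ 0 ↔ i ≠ i0 := by
    intro i; rw [hi0, Ne, Ne, Fin.ext_iff]
  have huv_ne : u ≠ v := huv.ne
  have hWv : ∀ i, T.Adj v (W i) := fun i => by
    have : W i ∈ T.neighborSet v \ {u} := hW ▸ Set.mem_range_self i
    exact this.1
  have hWu : ∀ i, W i ≠ u := fun i => by
    have : W i ∈ T.neighborSet v \ {u} := hW ▸ Set.mem_range_self i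
    exact this.2
  have hWnv : ∀ i, W i ≠ v := fun i => (hWv i).ne'
  have htri : ∀ i, ¬ T.Adj u (W i) := by
    intro i h
    have hp := (hT.2.subsingleton_path u (W i)).elim
      ⟨Walk.cons h Walk.nil, by simp [(hWu i).symm]⟩
      ⟨Walk.cons huv (Walk.cons (hWv i) Walk.nil), by
        simp [(hWu i).symm, (hWnv i).symm, huv_ne]⟩
    have := congrArg (fun p : T.Path u (W i) => p.1.length) hp
    simp at this
  have hadj : ∀ a b, T'.Adj a b ↔ ((T.Adj a b ∧ ¬ ∃ i, i ≠ i0 ∧ s(a,b) = s(v, W i)) ∨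
      ∃ i, i ≠ i0 ∧ s(a,b) = s(u, W i)) := by
    intro a b
    rw [← mem_edgeSet, hT']
    simp [hne0]
  -- degrees
  have hdu' : m + n ≤ T'.degree u := by
    have hsub : T.neighborFinset u ∪ (Finset.univ.erase i0).image W ⊆ T'.neighborFinset u := by
      intro x hx
      rw [mem_neighborFinset, hadj]
      rw [Finset.mem_union, mem_neighborFinset, Finset.mem_image] at hx
      rcases hx with hx | ⟨i, hi, rfl⟩
      · left
        refine ⟨hx, ?_⟩
        rintro ⟨i, hi, h⟩
        rw [Sym2.eq_iff] at h
        rcases h with h | h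
        · exact huv_ne h.1
        · exact hWu i h.1.symm
      · right
        exact ⟨i, (Finset.mem_erase.1 hi).1, rfl⟩
    have hdis : Disjoint (T.neighborFinset u) ((Finset.univ.erase i0).image W) := by
      rw [Finset.disjoint_left]
      intro x hx hx2
      rw [mem_neighborFinset] at hx
      obtain ⟨i, _, rfl⟩ := Finset.mem_image.1 hx2
      exact htri i hx
    have := Finset.card_le_card hsub
    rw [Finset.card_union_of_disjoint hdis, Finset.card_image_of_injective _ hWinj,
      card_neighborFinset_eq_degree, card_neighborFinset_eq_degree, hdu,
      Finset.card_erase_of_mem (Finset.mem_univ _), Finset.card_univ, Fintype.card_fin] at this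
    omega
  have hdv' : 2 ≤ T'.degree v := by
    have hsub : {u, W i0} ⊆ T'.neighborFinset v := by
      intro x hx
      rw [mem_neighborFinset, hadj]
      rw [Finset.mem_insert, Finset.mem_singleton] at hx
      left
      rcases hx with rfl | rfl
      · refine ⟨huv.symm, ?_⟩
        rintro ⟨i, hi, h⟩
        rw [Sym2.eq_iff] at h
        rcases h with h | h
        · exact hWu i h.2.symm
        · exact hWnv i h.1.symm
      · refine ⟨hWv i0, ?_⟩
        rintro ⟨i, hi, h⟩
        rw [Sym2.eq_iff] at h
        rcases h with h | h
        · exact hi (hWinj h.2.symm)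
        · exact hWnv i h.1.symm
    have := Finset.card_le_card hsub
    rwa [Finset.card_pair (hWu i0).symm, card_neighborFinset_eq_degree] at this
  have hdx' : ∀ x, x ≠ v → T.degree x ≤ T'.degree x := by
    intro x hxv
    rw [← card_neighborFinset_eq_degree, ← card_neighborFinset_eq_degree]
    by_cases hx : ∃ i, i ≠ i0 ∧ x = W i
    · obtain ⟨i, hi, rfl⟩ := hx
      apply Finset.card_le_card_of_injOn (Equiv.swap u v) _ (Equiv.injective _).injOn
      intro y hy
      simp only [Finset.mem_coe, mem_neighborFinset] at hy ⊢
      rw [hadj]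
      by_cases hyv : y = v
      · subst hyv
        right
        exact ⟨i, hi, by rw [Equiv.swap_apply_right, Sym2.eq_swap]⟩
      · have hyu : y ≠ u := by
          rintro rfl
          exact htri i hy.symm
        left
        rw [Equiv.swap_apply_of_ne_of_ne hyu hyv]
        refine ⟨hy, ?_⟩
        rintro ⟨j, hj, h⟩
        rw [Sym2.eq_iff] at h
        rcases h with h | h
        · exact hxv h.1
        · exact hyv h.2
    · apply Finset.card_le_card
      intro y hy
      simp only [mem_neighborFinset] at hy ⊢
      rw [hadj]
      left
      refine ⟨hy, ?_⟩
      rintro ⟨j, hj, h⟩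
      rw [Sym2.eq_iff] at h
      rcases h with h | h
      · exact hxv h.1
      · exact hx ⟨j, hj, h.1⟩
  set I : Finset (Fin n) := Finset.univ.erase i0 with hI
  set A : Finset (Sym2 V) := I.image (fun i => s(v, W i)) with hA
  set B : Finset (Sym2 V) := I.image (fun i => s(u, W i)) with hB
  have hinj : ∀ z, Function.Injective (fun i => s(z, W i)) := by
    intro z i j h
    exact hWinj (Sym2.congr_right.1 h)
  have hAE : A ⊆ T.edgeFinset := by
    intro e he
    obtain ⟨i, _, rfl⟩ := Finset.mem_image.1 he
    simpa using hWv i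
  have hE' : T'.edgeFinset = (T.edgeFinset \ A) ∪ B := by
    ext e
    rw [mem_edgeFinset, hT']
    simp [hne0, hA, hB, hI, eq_comm]
  have hdisj : Disjoint (T.edgeFinset \ A) B := by
    rw [Finset.disjoint_left]
    intro e he he2
    obtain ⟨i, _, rfl⟩ := Finset.mem_image.1 he2
    have := (Finset.mem_sdiff.1 he).1
    rw [mem_edgeFinset, mem_edgeSet] at this
    exact htri i this
  rw [so_eq T, so_eq T', hE', Finset.sum_union hdisj, ← Finset.sum_sdiff hAE, hA, hB,
    Finset.sum_image (hinj _).injOn, Finset.sum_image (hinj _).injOn, ← hA]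
  set w := soW (fun x => T.degree x) with hw
  set w' := soW (fun x => T'.degree x) with hw'
  have hC : (w' s(u,v) - w s(u,v)) + (w' s(v, W i0) - w s(v, W i0)) ≤
      ∑ e ∈ T.edgeFinset \ A, (w' e - w e) := by
    have hne : s(u,v) ≠ s(v, W i0) := by
      intro h
      rw [Sym2.eq_iff] at h
      rcases h with h | h
      · exact huv_ne h.1
      · exact hWu i0 h.1.symm
    rw [← Finset.sum_pair (f := fun e => w' e - w e) hne]
    apply Finset.sum_le_sum_of_subset_of_nonneg
    · intro e he
      rw [Finset.mem_insert, Finset.mem_singleton] at he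
      rw [Finset.mem_sdiff, mem_edgeFinset]
      rcases he with rfl | rfl
      · refine ⟨huv, ?_⟩
        intro h
        obtain ⟨i, _, h⟩ := Finset.mem_image.1 h
        rw [Sym2.eq_iff] at h
        rcases h with h | h
        · exact huv_ne h.1.symm
        · exact hWu i h.2
      · refine ⟨hWv i0, ?_⟩
        intro h
        obtain ⟨i, hi, h⟩ := Finset.mem_image.1 h
        exact (Finset.mem_erase.1 hi).1 (hinj v h)
    · intro e he hne
      induction e with | _ a b
      obtain ⟨heE, heA⟩ := Finset.mem_sdiff.1 he
      rw [mem_edgeFinset, mem_edgeSet] at heE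
      have key : ∀ b, T.Adj v b → s(v,b) ∉ A → s(v,b) ∈ ({s(u,v), s(v, W i0)} : Finset _) := by
        intro b hb hbA
        by_cases hbu : b = u
        · subst hbu; simp [Sym2.eq_swap]
        · have : b ∈ Set.range W := hW ▸ ⟨hb, hbu⟩
          obtain ⟨i, rfl⟩ := this
          by_cases hi : i = i0
          · subst hi; simp
          · exact absurd (Finset.mem_image.2 ⟨i, by simp [hI, hi], rfl⟩) hbA
      have ha : a ≠ v := by
        rintro rfl
        exact hne (key b heE heA)
      have hb : b ≠ v := by
        rintro rfl
        rw [Sym2.eq_swap (a := a)] at hne heA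
        exact hne (key a heE.symm heA)
      have h1 := hdx' a ha
      have h2 := hdx' b hb
      rw [hw, hw', soW_mk, soW_mk, sub_nonneg]
      gcongr
  have hD : ∀ i, √(((m:ℝ)+n)^2 + (T.degree (W i):ℝ)^2) - √(((n:ℝ)+1)^2 + (T.degree (W i):ℝ)^2)
      ≤ w' s(u, W i) - w s(v, W i) := by
    intro i
    rw [hw, hw', soW_mk, soW_mk, hdv]
    have h1 : ((m:ℝ)+n) ≤ T'.degree u := by exact_mod_cast hdu'
    have h2 := hdx' (W i) (hWnv i)
    push_cast
    gcongr
  have hmR : (n:ℝ) ≤ m := by exact_mod_cast hnm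
  have hnR : (2:ℝ) ≤ n := by exact_mod_cast hn2
  set i1 : Fin n := ⟨1, by omega⟩ with hi1
  have hS : w' s(u, W i1) - w s(v, W i1) ≤ ∑ i ∈ I, (w' s(u, W i) - w s(v, W i)) := by
    apply Finset.single_le_sum (f := fun i => w' s(u, W i) - w s(v, W i))
    · intro i _
      refine le_trans ?_ (hD i)
      rw [sub_nonneg]
      apply Real.sqrt_le_sqrt
      gcongr ?_ ^ 2 + _
      linarith
    · simp [hI, hi0, hi1]
  have hUV : w s(u,v) < w' s(u,v) := by
    rw [hw, hw', soW_mk, soW_mk, hdu, hdv]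
    apply Real.sqrt_lt_sqrt (by positivity)
    have h1 : ((m:ℝ)+n) ≤ T'.degree u := by exact_mod_cast hdu'
    have h2 : (2:ℝ) ≤ T'.degree v := by exact_mod_cast hdv'
    have h3 : ((m:ℝ)+n)^2 ≤ (T'.degree u : ℝ)^2 := by gcongr
    have h4 : (2:ℝ)^2 ≤ (T'.degree v : ℝ)^2 := by gcongr
    push_cast
    nlinarith
  have hV0 : √((2:ℝ)^2 + (T.degree (W i0):ℝ)^2) - √(((n:ℝ)+1)^2 + (T.degree (W i0):ℝ)^2)
      ≤ w' s(v, W i0) - w s(v, W i0) := by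
    rw [hw, hw', soW_mk, soW_mk, hdv]
    have h2 : (2:ℝ) ≤ T'.degree v := by exact_mod_cast hdv'
    have h3 := hdx' (W i0) (hWnv i0)
    push_cast
    gcongr
  have hd : (T.degree (W i1) : ℝ) ≤ T.degree (W i0) := by exact_mod_cast hmax i1
  have k1 := so_mono_diff ((m:ℝ)+n) ((n:ℝ)+1) (T.degree (W i1)) (T.degree (W i0))
    (by positivity) (by linarith) (by positivity) hd
  have k2 := so_convex ((m:ℝ)+n) 2 ((n:ℝ)+1) (T.degree (W i0)) (by positivity) (by positivity)
    (by positivity) (by linarith)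
  have k3 := hD i1
  rw [Finset.sum_sub_distrib] at hC hS
  linarith
end

section
/- Let T be a finite tree and let u, v ∈ V(T) be non-adjacent vertices with deg(u) = m and deg(v) = n, where m ≥ n ≥ 3, such that every internal vertex of the (unique) path in T from u to v has degree 2, and this path has length at least 2 with u₂ the neighbor of u on the path and v₂ the neighbor of v on the path. Write N(u) = {u₁, u₂, …, u_m} and N(v) = {v₁, v₂, …, v_n} (with u₂ and v₂ lying on the u–v path, possibly u₂ = v₂), and assume deg(v₁) ≥ deg(v_i) for all i ≥ 3. Let T* be the tree obtained from T by deleting the edges v v_i for all 3 ≤ i ≤ n and adding the edges u v_i for all 3 ≤ i ≤ n. Then SO(T*) > SO(T). -/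
open SimpleGraph

/-- Edge weight for a degree function. -/
noncomputable def edgeWt {V : Type*} (d : V → ℕ) (e : Sym2 V) : ℝ :=
  Sym2.lift ⟨fun a b => Real.sqrt ((d a : ℝ) ^ 2 + (d b : ℝ) ^ 2),
      fun a b => by simp [add_comm]⟩ e

lemma edgeWt_mk {V : Type*} (d : V → ℕ) (a b : V) :
    edgeWt d s(a, b) = Real.sqrt ((d a : ℝ) ^ 2 + (d b : ℝ) ^ 2) := rfl

lemma somborIndex_eq_edgeWt {V : Type*} [Fintype V] (G : SimpleGraph V)
    (E : Finset (Sym2 V)) (hE : ∀ e, e ∈ E ↔ e ∈ G.edgeSet) (d : V → ℕ)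
    (hd : ∀ w, (G.neighborSet w).ncard = d w) :
    somborIndex G = ∑ e ∈ E, edgeWt d e := by
  classical
  have hdeg : d = fun w => (G.neighborSet w).ncard := by
    funext w; exact (hd w).symm
  unfold somborIndex
  apply Finset.sum_congr
  · ext e
    rw [hE]
    exact SimpleGraph.mem_edgeFinset
  · intro e _
    induction e using Sym2.ind with
    | _ a b =>
      rw [edgeWt_mk, hdeg]
      simp only [Sym2.lift_mk, Set.ncard_eq_toFinset_card', SimpleGraph.degree,
        SimpleGraph.neighborFinset]

lemma sqrt_convex_aux (a b c e x : ℝ) (ha : 0 < a) (hab : a ≤ b) (hbc : b ≤ c)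
    (hs : a + e = b + c) :
    Real.sqrt (b ^ 2 + x ^ 2) + Real.sqrt (c ^ 2 + x ^ 2) ≤
      Real.sqrt (a ^ 2 + x ^ 2) + Real.sqrt (e ^ 2 + x ^ 2) := by
  have key : ∀ s t : ℝ, 0 < s → s ≤ t →
      s * Real.sqrt (t ^ 2 + x ^ 2) ≤ t * Real.sqrt (s ^ 2 + x ^ 2) := by
    intro s t hs hst
    have h1 : s * Real.sqrt (t ^ 2 + x ^ 2) = Real.sqrt (s ^ 2 * (t ^ 2 + x ^ 2)) := by
      rw [Real.sqrt_mul (sq_nonneg s), Real.sqrt_sq hs.le]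
    have h2 : t * Real.sqrt (s ^ 2 + x ^ 2) = Real.sqrt (t ^ 2 * (s ^ 2 + x ^ 2)) := by
      rw [Real.sqrt_mul (sq_nonneg t), Real.sqrt_sq (hs.le.trans hst)]
    rw [h1, h2]
    apply Real.sqrt_le_sqrt
    have : s ^ 2 ≤ t ^ 2 := by gcongr
    nlinarith [mul_le_mul_of_nonneg_right this (sq_nonneg x)]
  have k1 := key b e (by linarith) (by linarith)
  have k2 := key a e (by linarith) (by linarith)
  have k3 := key b c (by linarith) (by linarith)
  have k4 := key a c (by linarith) (by linarith)
  have pos : ∀ s : ℝ, 0 < s → 0 < Real.sqrt (s ^ 2 + x ^ 2) := by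
    intro s hs; positivity
  have sq : ∀ s : ℝ, Real.sqrt (s ^ 2 + x ^ 2) ^ 2 = s ^ 2 + x ^ 2 := by
    intro s; exact Real.sq_sqrt (by positivity)
  have pa := pos a ha
  have pb := pos b (by linarith)
  have pc := pos c (by linarith)
  have pe := pos e (by linarith)
  have sa := sq a
  have sb := sq b
  have sc := sq c
  have se := sq e
  generalize Real.sqrt (a ^ 2 + x ^ 2) = A at *
  generalize Real.sqrt (b ^ 2 + x ^ 2) = P at *
  generalize Real.sqrt (c ^ 2 + x ^ 2) = Q at *
  generalize Real.sqrt (e ^ 2 + x ^ 2) = E at *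
  have e1 : E - Q = (b - a) * (e + c) / (E + Q) := by
    rw [eq_div_iff (by positivity)]
    have : e - c = b - a := by linarith
    rw [← this]; linarith
  have e2 : P - A = (b - a) * (b + a) / (P + A) := by
    rw [eq_div_iff (by positivity)]
    linarith
  have : P - A ≤ E - Q := by
    rw [e1, e2, div_le_div_iff₀ (by positivity) (by positivity), mul_assoc, mul_assoc]
    apply mul_le_mul_of_nonneg_left _ (by linarith)
    nlinarith
  linarith

lemma sqrt_diff_aux (b e x y : ℝ) (hb : 0 < b) (hbe : b ≤ e) (hx : 0 ≤ x) (hxy : x ≤ y) :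
    Real.sqrt (e ^ 2 + y ^ 2) - Real.sqrt (b ^ 2 + y ^ 2) ≤
      Real.sqrt (e ^ 2 + x ^ 2) - Real.sqrt (b ^ 2 + x ^ 2) := by
  have he : 0 < e := by linarith
  have key : ∀ z : ℝ, Real.sqrt (e ^ 2 + z ^ 2) - Real.sqrt (b ^ 2 + z ^ 2) =
      (e ^ 2 - b ^ 2) / (Real.sqrt (e ^ 2 + z ^ 2) + Real.sqrt (b ^ 2 + z ^ 2)) := by
    intro z
    rw [eq_div_iff (by positivity)]
    have h1 := Real.sq_sqrt (show 0 ≤ e ^ 2 + z ^ 2 by positivity)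
    have h2 := Real.sq_sqrt (show 0 ≤ b ^ 2 + z ^ 2 by positivity)
    linarith
  rw [key, key]
  have : b ^ 2 ≤ e ^ 2 := by gcongr
  apply div_le_div_of_nonneg_left (by linarith) (by positivity)
  gcongr

/-- Lemma 2.6 (tree case, non-adjacent branch vertices joined by a path of
internal degree-2 vertices): moving the branches `v₃, …, v_n` of `v` over to
`u` (with `deg u = m ≥ n = deg v ≥ 3`) strictly increases the Sombor index. -/
theorem sombor_tree_shift_path {V : Type*} [Fintype V]
    (T : SimpleGraph V) [DecidableRel T.Adj] (hT : T.IsTree)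
    (u v : V) (hne : u ≠ v) (huv : ¬ T.Adj u v)
    (m n : ℕ) (hn3 : 3 ≤ n) (hnm : n ≤ m)
    (hdu : T.degree u = m) (hdv : T.degree v = n)
    (p : T.Walk u v) (hp : p.IsPath) (hplen : 2 ≤ p.length)
    (hpint : ∀ w ∈ p.support, w ≠ u → w ≠ v → T.degree w = 2)
    (U : Fin m → V) (hUinj : Function.Injective U)
    (hU : T.neighborSet u = Set.range U)
    (W : Fin n → V) (hWinj : Function.Injective W)
    (hW : T.neighborSet v = Set.range W)
    (hU2 : U ⟨1, by omega⟩ = p.getVert 1)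
    (hW2 : W ⟨1, by omega⟩ = p.getVert (p.length - 1))
    (hmax : ∀ i : Fin n, 2 ≤ (i : ℕ) → T.degree (W i) ≤ T.degree (W ⟨0, by omega⟩))
    (T' : SimpleGraph V)
    (hT' : T'.edgeSet =
      (T.edgeSet \ {e | ∃ i : Fin n, 2 ≤ (i : ℕ) ∧ e = s(v, W i)}) ∪
        {e | ∃ i : Fin n, 2 ≤ (i : ℕ) ∧ e = s(u, W i)}) :
    somborIndex T < somborIndex T' := by
  classical
  have hUadj : ∀ j, T.Adj u (U j) := fun j => by
    rw [← SimpleGraph.mem_neighborSet, hU]; exact ⟨j, rfl⟩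
  have hWadj : ∀ i, T.Adj v (W i) := fun i => by
    rw [← SimpleGraph.mem_neighborSet, hW]; exact ⟨i, rfl⟩
  have hWex : ∀ w, T.Adj v w → ∃ i, W i = w := fun w hw => by
    rw [← SimpleGraph.mem_neighborSet, hW] at hw; exact hw
  -- tree fact
  have htree : ∀ i : Fin n, 2 ≤ (i : ℕ) → ¬ T.Adj u (W i) := by
    intro i hi hadj
    let q : T.Walk u v := .cons hadj (.cons (hWadj i).symm .nil)
    have hq : q.IsPath := by
      simp [q, hne, hadj.ne, (hWadj i).ne']
    have hpq : p = q := by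
      have := (hT.isAcyclic.subsingleton_path u v).elim ⟨p, hp⟩ ⟨q, hq⟩
      exact congrArg Subtype.val this
    have h1 : W ⟨1, by omega⟩ = W i := by
      rw [hW2, hpq]; simp [q]
    have h2 := congrArg Fin.val (hWinj h1)
    simp at h2
    omega
  have hAdj' : ∀ a b, T'.Adj a b ↔
      (T.Adj a b ∧ ¬ ∃ i : Fin n, 2 ≤ (i : ℕ) ∧ s(a, b) = s(v, W i)) ∨
        ∃ i : Fin n, 2 ≤ (i : ℕ) ∧ s(a, b) = s(u, W i) := by
    intro a b
    rw [← SimpleGraph.mem_edgeSet, hT']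
    simp
  have hdU1 : T.degree (U ⟨1, by omega⟩) = 2 := by
    apply hpint
    · rw [hU2]; exact p.getVert_mem_support 1
    · exact (hUadj _).ne'
    · intro h; exact huv (h ▸ hUadj _)
  have hdW1 : T.degree (W ⟨1, by omega⟩) = 2 := by
    apply hpint
    · rw [hW2]; exact p.getVert_mem_support _
    · intro h; exact huv (h ▸ hWadj _).symm
    · exact (hWadj _).ne'
  have hWu : ∀ i, W i ≠ u := fun i h => huv (h ▸ hWadj i).symm
  have hWv : ∀ i, W i ≠ v := fun i => (hWadj i).ne'
  have hUv : ∀ i, U i ≠ v := fun i h => huv (h ▸ hUadj i)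
  have hUu : ∀ i, U i ≠ u := fun i => (hUadj i).ne'
  let R : Finset (Fin n) := Finset.univ.filter (fun i => 2 ≤ (i : ℕ))
  have hR : ∀ i, i ∈ R ↔ 2 ≤ (i : ℕ) := by intro i; simp [R]
  let i0 : Fin n := ⟨0, by omega⟩
  let i1 : Fin n := ⟨1, by omega⟩
  let i2 : Fin n := ⟨2, by omega⟩
  have h01 : i0 ≠ i1 := by simp [i0, i1]
  have hRc : R = Finset.univ \ {i0, i1} := by
    ext i
    simp only [hR, Finset.mem_sdiff, Finset.mem_univ, true_and, Finset.mem_insert,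
      Finset.mem_singleton, i0, i1, Fin.ext_iff]
    omega
  have hRcard : R.card = n - 2 := by
    rw [hRc, Finset.card_sdiff_of_subset (Finset.subset_univ _), Finset.card_pair h01]
    simp
  -- degree functions
  let d : V → ℕ := fun w => T.degree w
  let d' : V → ℕ := fun w => if w = u then m + n - 2 else if w = v then 2 else T.degree w
  have hd : ∀ w, (T.neighborSet w).ncard = d w := by
    intro w
    rw [Set.ncard_eq_toFinset_card']; rfl
  have hd' : ∀ w, (T'.neighborSet w).ncard = d' w := by
    intro w
    by_cases hwu : w = u
    · subst hwu
      have : T'.neighborSet w = ↑(T.neighborFinset w ∪ R.image W) := by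
        ext x
        simp only [SimpleGraph.mem_neighborSet, hAdj', Finset.coe_union, Set.mem_union,
          Finset.mem_coe, SimpleGraph.mem_neighborFinset, Finset.mem_image, hR]
        constructor
        · rintro (⟨h, _⟩ | ⟨i, hi, h⟩)
          · exact Or.inl h
          · right; refine ⟨i, hi, ?_⟩
            exact (Sym2.congr_right.1 h).symm
        · rintro (h | ⟨i, hi, rfl⟩)
          · left; refine ⟨h, ?_⟩
            rintro ⟨i, hi, h'⟩
            rw [Sym2.eq_iff] at h'
            rcases h' with ⟨h1, _⟩ | ⟨h1, _⟩
            · exact hne h1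
            · exact hWu i h1.symm
          · exact Or.inr ⟨i, hi, rfl⟩
      rw [this, Set.ncard_coe_finset, Finset.card_union_of_disjoint,
        Finset.card_image_of_injective _ hWinj, hRcard, SimpleGraph.card_neighborFinset_eq_degree,
        hdu]
      · simp only [d', if_true]; omega
      · rw [Finset.disjoint_left]
        intro x hx hx'
        obtain ⟨i, hi, rfl⟩ := Finset.mem_image.1 hx'
        exact htree i ((hR i).1 hi) (by simpa using hx)
    by_cases hwv : w = v
    · subst hwv
      have : T'.neighborSet w = {W i0, W i1} := by
        ext x
        simp only [SimpleGraph.mem_neighborSet, hAdj', Set.mem_insert_iff,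
          Set.mem_singleton_iff]
        constructor
        · rintro (⟨h, h'⟩ | ⟨i, hi, h⟩)
          · obtain ⟨i, rfl⟩ := hWex x h
            have hi : ¬ 2 ≤ (i : ℕ) := fun hi => h' ⟨i, hi, rfl⟩
            have : i = i0 ∨ i = i1 := by
              simp only [i0, i1, Fin.ext_iff]; omega
            rcases this with h | h <;> simp [h]
          · rw [Sym2.eq_iff] at h
            rcases h with ⟨h1, _⟩ | ⟨h1, _⟩
            · exact absurd h1 hwu
            · exact absurd h1.symm (hWv i)
        · have aux : ∀ j : Fin n, (j : ℕ) < 2 →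
              ¬ ∃ i : Fin n, 2 ≤ (i : ℕ) ∧ s(w, W j) = s(w, W i) := by
            rintro j hj ⟨i, hi, h⟩
            have : W j = W i := Sym2.congr_right.1 h
            have := hWinj this
            subst this
            omega
          rintro (rfl | rfl)
          · exact Or.inl ⟨hWadj _, aux i0 (by simp [i0])⟩
          · exact Or.inl ⟨hWadj _, aux i1 (by simp [i1])⟩
      rw [this, Set.ncard_pair (fun h => h01 (hWinj h))]
      simp [d', hwu]
    have hdw : d' w = (T.neighborSet w).ncard := by
      rw [hd]; simp [d', d, hwu, hwv]
    rw [hdw]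
    by_cases hwW : ∃ i : Fin n, 2 ≤ (i : ℕ) ∧ W i = w
    · obtain ⟨i, hi, rfl⟩ := hwW
      have hS : T'.neighborSet (W i) = insert u (T.neighborSet (W i) \ {v}) := by
        ext x
        simp only [SimpleGraph.mem_neighborSet, hAdj', Set.mem_insert_iff, Set.mem_sdiff,
          Set.mem_singleton_iff, Sym2.eq_iff]
        constructor
        · rintro (⟨h, h'⟩ | ⟨j, hj, h⟩)
          · right
            exact ⟨h, fun hx => h' ⟨i, hi, Or.inr ⟨rfl, hx⟩⟩⟩
          · rcases h with ⟨h1, _⟩ | ⟨_, h1⟩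
            · exact absurd h1 hwu
            · exact Or.inl h1
        · rintro (rfl | ⟨h, hx⟩)
          · exact Or.inr ⟨i, hi, Or.inr ⟨rfl, rfl⟩⟩
          · left; refine ⟨h, ?_⟩
            rintro ⟨j, hj, ⟨h1, _⟩ | ⟨_, h1⟩⟩
            · exact hwv h1
            · exact hx h1
      rw [hS, Set.ncard_insert_of_notMem, Set.ncard_sdiff_singleton_add_one]
      · exact (hWadj i).symm
      · intro h
        exact htree i hi (SimpleGraph.Adj.symm h.1)
    · congr 1
      ext x
      simp only [SimpleGraph.mem_neighborSet, hAdj', Sym2.eq_iff]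
      constructor
      · rintro (⟨h, _⟩ | ⟨j, hj, ⟨h1, _⟩ | ⟨h1, _⟩⟩)
        · exact h
        · exact absurd h1 hwu
        · exact absurd ⟨j, hj, h1.symm⟩ hwW
      · intro h
        left; refine ⟨h, ?_⟩
        rintro ⟨j, hj, ⟨h1, _⟩ | ⟨h1, _⟩⟩
        · exact hwv h1
        · exact hwW ⟨j, hj, h1.symm⟩
  -- edge sets
  let A : Finset (Sym2 V) := T.edgeFinset \ R.image (fun i => s(v, W i))
  have hsub : R.image (fun i => s(v, W i)) ⊆ T.edgeFinset := by
    intro e he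
    obtain ⟨i, _, rfl⟩ := Finset.mem_image.1 he
    simpa using hWadj i
  have hinj : ∀ a : V, Set.InjOn (fun i => s(a, W i)) (R : Set (Fin n)) := by
    intro a i _ j _ h
    exact hWinj (Sym2.congr_right.1 h)
  have hSO : somborIndex T = ∑ e ∈ A, edgeWt d e + ∑ i ∈ R, edgeWt d s(v, W i) := by
    rw [somborIndex_eq_edgeWt T T.edgeFinset (fun e => SimpleGraph.mem_edgeFinset) d hd,
      ← Finset.sum_sdiff hsub, Finset.sum_image (hinj v)]
  have hSO' : somborIndex T' = ∑ e ∈ A, edgeWt d' e + ∑ i ∈ R, edgeWt d' s(u, W i) := by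
    rw [somborIndex_eq_edgeWt T' (A ∪ R.image (fun i => s(u, W i))) _ d' hd',
      Finset.sum_union, Finset.sum_image (hinj u)]
    · rw [Finset.disjoint_left]
      intro e he he'
      obtain ⟨i, hi, rfl⟩ := Finset.mem_image.1 he'
      have : s(u, W i) ∈ T.edgeFinset := (Finset.mem_sdiff.1 he).1
      exact htree i ((hR i).1 hi) (by simpa using this)
    · intro e
      rw [hT']
      simp [A, hR, eq_comm]
  have hd'u : d' u = m + n - 2 := by simp [d']
  have hd'v : d' v = 2 := by simp [d', hne.symm]
  have hd'o : ∀ w, w ≠ u → w ≠ v → d' w = d w := by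
    intro w h1 h2; simp [d', d, h1, h2]
  have hd'W : ∀ i, d' (W i) = d (W i) := fun i => hd'o _ (hWu i) (hWv i)
  have hd'U : ∀ i, d' (U i) = d (U i) := fun i => hd'o _ (hUu i) (hUv i)
  have hdu' : d u = m := hdu
  have hdv' : d v = n := hdv
  have hm3 : (3 : ℝ) ≤ m := by exact_mod_cast hn3.trans hnm
  have hn3' : (3 : ℝ) ≤ n := by exact_mod_cast hn3
  have hnm' : (n : ℝ) ≤ m := by exact_mod_cast hnm
  have hcast : ((m + n - 2 : ℕ) : ℝ) = m + n - 2 := by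
    rw [Nat.cast_sub (by omega)]; push_cast; ring
  let j0 : Fin m := ⟨0, by omega⟩
  let j1 : Fin m := ⟨1, by omega⟩
  have hj01 : j0 ≠ j1 := by simp [j0, j1]
  let B : Finset (Sym2 V) := {s(u, U j0), s(u, U j1), s(v, W i0), s(v, W i1)}
  have hBA : B ⊆ A := by
    intro e he
    simp only [B, Finset.mem_insert, Finset.mem_singleton] at he
    simp only [A, Finset.mem_sdiff, SimpleGraph.mem_edgeFinset, Finset.mem_image, hR]
    rcases he with rfl | rfl | rfl | rfl
    · refine ⟨hUadj _, ?_⟩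
      rintro ⟨i, hi, h⟩
      rw [Sym2.eq_iff] at h
      rcases h with ⟨h, _⟩ | ⟨h, _⟩
      · exact hne h.symm
      · exact hUv _ h.symm
    · refine ⟨hUadj _, ?_⟩
      rintro ⟨i, hi, h⟩
      rw [Sym2.eq_iff] at h
      rcases h with ⟨h, _⟩ | ⟨h, _⟩
      · exact hne h.symm
      · exact hUv _ h.symm
    · refine ⟨hWadj _, ?_⟩
      rintro ⟨i, hi, h⟩
      have : i = i0 := hWinj (Sym2.congr_right.1 h)
      subst this; simp [i0] at hi
    · refine ⟨hWadj _, ?_⟩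
      rintro ⟨i, hi, h⟩
      have : i = i1 := hWinj (Sym2.congr_right.1 h)
      subst this; simp [i1] at hi
  have hrest : ∑ e ∈ A \ B, edgeWt d e ≤ ∑ e ∈ A \ B, edgeWt d' e := by
    apply Finset.sum_le_sum
    intro e he
    rw [Finset.mem_sdiff] at he
    obtain ⟨heA, heB⟩ := he
    have hnv : v ∉ e := by
      intro hv
      obtain ⟨x, rfl⟩ := hv
      have hx := (Finset.mem_sdiff.1 heA).1
      have hx' := (Finset.mem_sdiff.1 heA).2
      obtain ⟨i, rfl⟩ := hWex x (by simpa using hx)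
      have hi : ¬ 2 ≤ (i : ℕ) := fun hi => hx' (Finset.mem_image.2 ⟨i, (hR i).2 hi, rfl⟩)
      have : i = i0 ∨ i = i1 := by
        simp only [i0, i1, Fin.ext_iff]; omega
      rcases this with rfl | rfl <;> simp [B] at heB
    have hle : ∀ w, w ≠ v → d w ≤ d' w := by
      intro w hw
      by_cases hwu : w = u
      · subst hwu; rw [hd'u, hdu']; omega
      · rw [hd'o w hwu hw]
    induction e using Sym2.ind with
    | _ a b =>
      simp only [Sym2.mem_iff, not_or] at hnv
      have h1 := hle a (Ne.symm hnv.1)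
      have h2 := hle b (Ne.symm hnv.2)
      rw [edgeWt_mk, edgeWt_mk]
      gcongr
  have hBsum : ∀ f : Sym2 V → ℝ, ∑ e ∈ B, f e =
      f s(u, U j0) + (f s(u, U j1) + (f s(v, W i0) + f s(v, W i1))) := by
    intro f
    have hUne : U j0 ≠ U j1 := fun h => hj01 (hUinj h)
    have hWne : W i0 ≠ W i1 := fun h => h01 (hWinj h)
    rw [Finset.sum_insert, Finset.sum_insert, Finset.sum_insert, Finset.sum_singleton]
    · simp only [Finset.mem_singleton, Sym2.eq_iff]
      grind
    · simp only [Finset.mem_insert, Finset.mem_singleton, Sym2.eq_iff]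
      grind
    · simp only [Finset.mem_insert, Finset.mem_singleton, Sym2.eq_iff]
      grind
  have hAsum : ∀ f : Sym2 V → ℝ, ∑ e ∈ A, f e = ∑ e ∈ A \ B, f e + ∑ e ∈ B, f e :=
    fun f => (Finset.sum_sdiff hBA).symm
  have hi2 : i2 ∈ R := by simp [hR, i2]
  have hRsum : ∀ f : Fin n → ℝ, ∑ i ∈ R, f i = f i2 + ∑ i ∈ R.erase i2, f i :=
    fun f => (Finset.add_sum_erase R f hi2).symm
  have hRrest : ∑ i ∈ R.erase i2, edgeWt d s(v, W i) ≤
      ∑ i ∈ R.erase i2, edgeWt d' s(u, W i) := by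
    apply Finset.sum_le_sum
    intro i _
    rw [edgeWt_mk, edgeWt_mk, hd'W, hd'u, hdv']
    gcongr
    omega
  have hU0 : edgeWt d s(u, U j0) < edgeWt d' s(u, U j0) := by
    rw [edgeWt_mk, edgeWt_mk, hd'U, hd'u, hdu']
    gcongr
    omega
  have hmid : edgeWt d s(u, U j1) + edgeWt d s(v, W i1) ≤
      edgeWt d' s(u, U j1) + edgeWt d' s(v, W i1) := by
    have e1 : d (U j1) = 2 := hdU1
    have e2 : d (W i1) = 2 := hdW1
    simp only [edgeWt_mk, hd'U, hd'W, hd'u, hd'v, hdu', hdv', hcast, e1, e2]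
    have := sqrt_convex_aux 2 n m (m + n - 2) 2 (by norm_num) (by linarith) hnm' (by ring)
    push_cast
    linarith
  have hend : edgeWt d s(v, W i0) + edgeWt d s(v, W i2) ≤
      edgeWt d' s(v, W i0) + edgeWt d' s(u, W i2) := by
    have hle : (d (W i2) : ℝ) ≤ d (W i0) := by exact_mod_cast hmax i2 (by simp [i2])
    simp only [edgeWt_mk, hd'W, hd'u, hd'v, hdv', hcast]
    have h1 := sqrt_convex_aux 2 n n (2 * n - 2) (d (W i0)) (by norm_num) (by linarith) le_rfl
      (by ring)
    have h2 := sqrt_diff_aux n (m + n - 2) (d (W i2)) (d (W i0)) (by linarith) (by linarith)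
      (by positivity) hle
    have h3 : Real.sqrt ((2 * n - 2 : ℝ) ^ 2 + (d (W i0) : ℝ) ^ 2) ≤
        Real.sqrt ((m + n - 2 : ℝ) ^ 2 + (d (W i0) : ℝ) ^ 2) := by
      apply Real.sqrt_le_sqrt
      nlinarith
    push_cast
    linarith
  rw [hSO, hSO', hAsum, hAsum, hBsum, hBsum, hRsum, hRsum]
  linarith
end

section
/- Let G be a unicyclic graph and let u be a vertex on the cycle of G to which two paths P_l and P_m are attached, of lengths l = 2 and m ≥ 2 respectively (all internal vertices of the attached paths having degree 2 in G), so that deg(u) ≥ 4. Let v_l be the pendant end-vertex of P_l, with v_{l-1} its neighbor on P_l, and let u_m be the pendant end-vertex of P_m. Let G* be the graph obtained from G by deleting the edge v_l v_{l-1} and adding the edge u_m v_l. Then SO(G*) > SO(G). -/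
open SimpleGraph

/-- A unicyclic graph: a connected graph whose number of edges equals its
number of vertices (equivalently, a connected graph with exactly one cycle). -/
def Unicyclic {V : Type*} [Fintype V] (G : SimpleGraph V) : Prop :=
  letI := Classical.decEq V
  letI : DecidableRel G.Adj := Classical.decRel _
  G.Connected ∧ G.edgeFinset.card = Fintype.card V

/-- The Sombor edge weight for a given degree function. -/
noncomputable def somborT {V : Type*} (d : V → ℕ) (e : Sym2 V) : ℝ :=
  Sym2.lift ⟨fun a b => Real.sqrt ((d a : ℝ) ^ 2 + (d b : ℝ) ^ 2),
      fun a b => by simp [add_comm]⟩ e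

theorem somborT_mk {V : Type*} (d : V → ℕ) (x y : V) :
    somborT d s(x, y) = Real.sqrt ((d x : ℝ) ^ 2 + (d y : ℝ) ^ 2) := rfl

theorem somborIndex_eq {V : Type*} [Fintype V] (G : SimpleGraph V) [DecidableRel G.Adj] :
    somborIndex G = ∑ e ∈ G.edgeFinset, somborT (fun v => G.degree v) e := by
  unfold somborIndex somborT
  simp only
  congr!

theorem sombor_num (d : ℕ) (hd : 4 ≤ d) :
    √((d : ℝ) ^ 2 + 2 ^ 2) + √((2 : ℝ) ^ 2 + 1 ^ 2) < √((d : ℝ) ^ 2 + 1 ^ 2) + √((2 : ℝ) ^ 2 + 2 ^ 2) := by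
  have hd' : (4 : ℝ) ≤ d := by exact_mod_cast hd
  have h1 : √((2 : ℝ) ^ 2 + 1 ^ 2) < 224 / 100 := by
    rw [Real.sqrt_lt' (by norm_num)]; norm_num
  have h2 : 282 / 100 < √((2 : ℝ) ^ 2 + 2 ^ 2) := by
    rw [Real.lt_sqrt (by norm_num)]; norm_num
  have h3 : 4 ≤ √((d : ℝ) ^ 2 + 1 ^ 2) := by
    apply Real.le_sqrt_of_sq_le; nlinarith
  have h5 := Real.sq_sqrt (show (0 : ℝ) ≤ (d : ℝ) ^ 2 + 1 ^ 2 by positivity)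
  have h6 := Real.sq_sqrt (show (0 : ℝ) ≤ (d : ℝ) ^ 2 + 2 ^ 2 by positivity)
  have h7 := Real.sqrt_nonneg ((d : ℝ) ^ 2 + 2 ^ 2)
  generalize √((d : ℝ) ^ 2 + 1 ^ 2) = x at *
  generalize √((d : ℝ) ^ 2 + 2 ^ 2) = y at *
  generalize √((2 : ℝ) ^ 2 + 1 ^ 2) = z at *
  generalize √((2 : ℝ) ^ 2 + 2 ^ 2) = t at *
  have h4 : y < x + 1 / 2 := by nlinarith
  linarith

set_option maxHeartbeats 1600000 in
open Classical in
theorem sombor_core {V : Type*} [Fintype V] (G G' : SimpleGraph V) (u a b w c : V)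
    (hua : u ≠ a) (hub : u ≠ b) (huw : u ≠ w) (huc : u ≠ c) (hab : a ≠ b) (haw : a ≠ w)
    (hac : a ≠ c) (hbw : b ≠ w) (hbc : b ≠ c) (hwc : w ≠ c)
    (hdu : 4 ≤ G.degree u) (hda : G.degree a = 2) (hdb : G.degree b = 1) (hdw : G.degree w = 2)
    (hdc : G.degree c = 1) (aua : G.Adj u a) (aab : G.Adj a b) (awc : G.Adj w c)
    (hG' : G'.edgeSet = (G.edgeSet \ {s(a, b)}) ∪ {s(c, b)}) :
    somborIndex G < somborIndex G' := by
  have adj' : ∀ x y, G'.Adj x y ↔ (G.Adj x y ∧ s(x, y) ≠ s(a, b)) ∨ s(x, y) = s(c, b) := by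
    intro x y
    rw [← mem_edgeSet, hG']; simp; tauto
  have na : G.neighborFinset a = {u, b} := by
    symm
    apply Finset.eq_of_subset_of_card_le
    · intro x hx
      simp only [Finset.mem_insert, Finset.mem_singleton] at hx
      rcases hx with rfl | rfl <;> simp [aab, aua.symm]
    · rw [card_neighborFinset_eq_degree, hda, Finset.card_pair hub]
  have nb : G.neighborFinset b = {a} := by
    symm
    apply Finset.eq_of_subset_of_card_le
    · intro x hx
      simp only [Finset.mem_singleton] at hx
      subst hx; simp [aab.symm]
    · rw [card_neighborFinset_eq_degree, hdb, Finset.card_singleton]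
  have nc : G.neighborFinset c = {w} := by
    symm
    apply Finset.eq_of_subset_of_card_le
    · intro x hx
      simp only [Finset.mem_singleton] at hx
      subst hx; simp [awc.symm]
    · rw [card_neighborFinset_eq_degree, hdc, Finset.card_singleton]
  have ga : ∀ x, G.Adj a x ↔ x = u ∨ x = b := by
    intro x; rw [← mem_neighborFinset, na]; simp
  have gb : ∀ x, G.Adj b x ↔ x = a := by
    intro x; rw [← mem_neighborFinset, nb]; simp
  have gc : ∀ x, G.Adj c x ↔ x = w := by
    intro x; rw [← mem_neighborFinset, nc]; simp
  have da' : G'.degree a = 1 := by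
    rw [← card_neighborFinset_eq_degree, Finset.card_eq_one]
    refine ⟨u, ?_⟩
    ext x
    simp only [mem_neighborFinset, adj', ga, Finset.mem_singleton, ne_eq, Sym2.eq_iff]
    grind
  have db' : G'.degree b = 1 := by
    rw [← card_neighborFinset_eq_degree, Finset.card_eq_one]
    refine ⟨c, ?_⟩
    ext x
    simp only [mem_neighborFinset, adj', gb, Finset.mem_singleton, ne_eq, Sym2.eq_iff]
    grind
  have dc' : G'.degree c = 2 := by
    rw [← card_neighborFinset_eq_degree, Finset.card_eq_two]
    refine ⟨w, b, hbw.symm, ?_⟩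
    ext x
    simp only [mem_neighborFinset, adj', gc, Finset.mem_singleton, Finset.mem_insert, ne_eq,
      Sym2.eq_iff]
    grind
  have dx' : ∀ x, x ≠ a → x ≠ b → x ≠ c → G'.degree x = G.degree x := by
    intro x h1 h2 h3
    rw [← card_neighborFinset_eq_degree, ← card_neighborFinset_eq_degree]
    congr 1
    ext y
    simp only [mem_neighborFinset, adj', ne_eq, Sym2.eq_iff]
    grind
  set R := G.edgeFinset \ {s(a, b), s(u, a), s(w, c)} with hR
  have e1 : G.edgeFinset = insert s(a, b) (insert s(u, a) (insert s(w, c) R)) := by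
    ext e
    simp only [hR, Finset.mem_insert, Finset.mem_sdiff, Finset.mem_singleton, mem_edgeFinset]
    have := (mem_edgeSet G).2 aab
    have := (mem_edgeSet G).2 aua
    have := (mem_edgeSet G).2 awc
    grind
  have ncb : s(c, b) ∉ G.edgeSet := by
    rw [mem_edgeSet, gc]; exact hbw
  have n1 : s(a, b) ≠ s(u, a) := by simp only [ne_eq, Sym2.eq_iff]; grind
  have n2 : s(a, b) ≠ s(w, c) := by simp only [ne_eq, Sym2.eq_iff]; grind
  have n3 : s(u, a) ≠ s(w, c) := by simp only [ne_eq, Sym2.eq_iff]; grind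
  have n4 : s(c, b) ≠ s(u, a) := by simp only [ne_eq, Sym2.eq_iff]; grind
  have n5 : s(c, b) ≠ s(w, c) := by simp only [ne_eq, Sym2.eq_iff]; grind
  have e2 : G'.edgeFinset = insert s(c, b) (insert s(u, a) (insert s(w, c) R)) := by
    ext e
    simp only [hR, Finset.mem_insert, Finset.mem_sdiff, Finset.mem_singleton, mem_edgeFinset, hG',
      Set.mem_union, Set.mem_sdiff, Set.mem_singleton_iff]
    have := (mem_edgeSet G).2 aab
    have := (mem_edgeSet G).2 aua
    have := (mem_edgeSet G).2 awc
    grind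
  have hRs : ∑ e ∈ R, somborT (fun v => G.degree v) e
      = ∑ e ∈ R, somborT (fun v => G'.degree v) e := by
    apply Finset.sum_congr rfl
    intro e he
    induction e using Sym2.ind with
    | _ x y =>
      simp only [hR, Finset.mem_insert, Finset.mem_sdiff, Finset.mem_singleton, mem_edgeFinset,
        mem_edgeSet, Sym2.eq_iff] at he
      obtain ⟨hxy, hn⟩ := he
      have hyx := hxy.symm
      have hx : x ≠ a ∧ x ≠ b ∧ x ≠ c := by
        refine ⟨?_, ?_, ?_⟩ <;> rintro rfl
        · rw [ga] at hxy; grind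
        · rw [gb] at hxy; grind
        · rw [gc] at hxy; grind
      have hy : y ≠ a ∧ y ≠ b ∧ y ≠ c := by
        refine ⟨?_, ?_, ?_⟩ <;> rintro rfl
        · rw [ga] at hyx; grind
        · rw [gb] at hyx; grind
        · rw [gc] at hyx; grind
      rw [somborT_mk, somborT_mk, dx' x hx.1 hx.2.1 hx.2.2, dx' y hy.1 hy.2.1 hy.2.2]
  have r1 : s(w, c) ∉ R := by simp [hR]
  have r2 : s(u, a) ∉ insert s(w, c) R := by simp [hR, n3]
  have r3 : s(a, b) ∉ insert s(u, a) (insert s(w, c) R) := by simp [hR, n1, n2]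
  have r4 : s(c, b) ∉ insert s(u, a) (insert s(w, c) R) := by
    have : s(c, b) ∉ R := by
      intro h; rw [hR, Finset.mem_sdiff, mem_edgeFinset] at h; exact ncb h.1
    rw [Finset.mem_insert, Finset.mem_insert]; tauto
  rw [somborIndex_eq, somborIndex_eq, e1, e2, Finset.sum_insert r3, Finset.sum_insert r2,
    Finset.sum_insert r1, Finset.sum_insert r4, Finset.sum_insert r2, Finset.sum_insert r1, hRs]
  simp only [somborT_mk, da', db', dc', dx' u hua hub huc, dx' w haw.symm hbw.symm hwc, hda, hdb,
    hdw, hdc]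
  have := sombor_num (G.degree u) hdu
  push_cast
  linarith

/-- Lemma 3.2: in a unicyclic graph with two paths `P_l` (of length `l = 2`) and
`P_m` (of length `m ≥ 2`) attached to a single vertex `u` of the cycle with
`deg u ≥ 4`, deleting the last edge of `P_l` and re-attaching the lost pendant
vertex to the end of `P_m` strictly increases the Sombor index. -/
theorem sombor_move_pendant_lt {V : Type*} [Fintype V]
    (G : SimpleGraph V) [DecidableRel G.Adj] (hG : Unicyclic G)
    (u : V) (hcyc : ∃ c : G.Walk u u, c.IsCycle) (hdu : 4 ≤ G.degree u)
    (m : ℕ) (hm : 2 ≤ m)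
    (P : ℕ → V) (hP0 : P 0 = u)
    (hPadj : ∀ i < 2, G.Adj (P i) (P (i + 1)))
    (hPinj : ∀ i ≤ 2, ∀ j ≤ 2, P i = P j → i = j)
    (hPint : G.degree (P 1) = 2)
    (hPend : G.degree (P 2) = 1)
    (Q : ℕ → V) (hQ0 : Q 0 = u)
    (hQadj : ∀ i < m, G.Adj (Q i) (Q (i + 1)))
    (hQinj : ∀ i ≤ m, ∀ j ≤ m, Q i = Q j → i = j)
    (hQint : ∀ i, 0 < i → i < m → G.degree (Q i) = 2)
    (hQend : G.degree (Q m) = 1)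
    (hPQ : ∀ i, 0 < i → i ≤ 2 → ∀ j, 0 < j → j ≤ m → P i ≠ Q j)
    (G' : SimpleGraph V)
    (hG' : G'.edgeSet = (G.edgeSet \ {s(P 1, P 2)}) ∪ {s(Q m, P 2)}) :
    somborIndex G < somborIndex G' := by
  classical
  obtain ⟨k, rfl⟩ : ∃ k, m = k + 1 := ⟨m - 1, by omega⟩
  have cv : ∀ (v : V) (n : ℕ) (i1 i2 : Fintype (G.neighborSet v)),
      @SimpleGraph.degree V G v i1 = n → @SimpleGraph.degree V G v i2 = n := by
    intro v n i1 i2 h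
    rw [← h]; congr!
  refine sombor_core G G' u (P 1) (P 2) (Q k) (Q (k + 1)) ?_ ?_ ?_ ?_ ?_ ?_ ?_ ?_ ?_ ?_ ?_
    (cv _ _ _ _ hPint) (cv _ _ _ _ hPend) (cv _ _ _ _ (hQint k (by omega) (by omega)))
    (cv _ _ _ _ hQend) ?_ (hPadj 1 (by omega)) (hQadj k (by omega)) hG'
  · intro h; have := hPinj 0 (by omega) 1 (by omega) (hP0.trans h); omega
  · intro h; have := hPinj 0 (by omega) 2 (by omega) (hP0.trans h); omega
  · intro h; have := hQinj 0 (by omega) k (by omega) (hQ0.trans h); omega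
  · intro h; have := hQinj 0 (by omega) (k + 1) (by omega) (hQ0.trans h); omega
  · intro h; have := hPinj 1 (by omega) 2 (by omega) h; omega
  · exact hPQ 1 (by omega) (by omega) k (by omega) (by omega)
  · exact hPQ 1 (by omega) (by omega) (k + 1) (by omega) (by omega)
  · exact hPQ 2 (by omega) (by omega) k (by omega) (by omega)
  · exact hPQ 2 (by omega) (by omega) (k + 1) (by omega) (by omega)
  · intro h; have := hQinj k (by omega) (k + 1) (by omega) h; omega
  · rw [cv u _ _ _ rfl]; exact hdu
  · have := hPadj 0 (by omega)
    rwa [hP0] at this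
end

section
/- Let G be a unicyclic graph containing a cycle, let u be a vertex on the cycle with cycle-neighbors x and y satisfying deg(y) ≥ deg(x), and let v be a vertex not on the cycle with u adjacent to v and deg(v) ≥ 3, such that v is the only vertex of degree ≥ 3 in the tree component containing v obtained by deleting the edge u v. Write N(u) = {x, y, v} ∪ {u₁,…,u_n} and N(v) = {u} ∪ {v₁,…,v_m}, and suppose deg(v) > deg(u) (i.e. m > n + 2). Let G* be the graph obtained from G by deleting the edges u u_i for all 1 ≤ i ≤ n and the edge u x, and adding the edges v u_i for all 1 ≤ i ≤ n and the edge v x. Then SO(G*) > SO(G). -/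
open SimpleGraph

noncomputable def ff (p q : ℝ) : ℝ := Real.sqrt (p ^ 2 + q ^ 2)

lemma ff_comm (p q : ℝ) : ff p q = ff q p := by simp [ff, add_comm]

lemma ff_mono {p q p' q' : ℝ} (hp : 0 ≤ p) (hq : 0 ≤ q) (h : p ≤ p') (h' : q ≤ q') :
    ff p q ≤ ff p' q' := by
  unfold ff
  apply Real.sqrt_le_sqrt
  gcongr

lemma ff_num (a b d e : ℝ) (ha : 3 ≤ a) (hb : a < b) (hd : 0 ≤ d) (he : d ≤ e) :
    ff a d + ff a e + ff a b < ff (a + b - 2) d + ff 2 e + ff 2 (a + b - 2) := by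
  have h1 : ff a b < ff 2 (a + b - 2) := by
    unfold ff
    apply Real.sqrt_lt_sqrt (by positivity)
    nlinarith [mul_pos (show 0 < a - 2 by linarith) (show 0 < b - 2 by linarith)]
  have h2 : ff a e + ff 2 d ≤ ff a d + ff 2 e := by
    have e1 : ff a e ^ 2 = a ^ 2 + e ^ 2 := Real.sq_sqrt (by positivity)
    have e2 : ff 2 d ^ 2 = 2 ^ 2 + d ^ 2 := Real.sq_sqrt (by positivity)
    have e3 : ff a d ^ 2 = a ^ 2 + d ^ 2 := Real.sq_sqrt (by positivity)
    have e4 : ff 2 e ^ 2 = 2 ^ 2 + e ^ 2 := Real.sq_sqrt (by positivity)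
    have p1 : 0 ≤ ff a e := Real.sqrt_nonneg _
    have p2 : 0 ≤ ff 2 d := Real.sqrt_nonneg _
    have p3 : 0 ≤ ff a d := Real.sqrt_nonneg _
    have p4 : 0 ≤ ff 2 e := Real.sqrt_nonneg _
    have h : ff a e * ff 2 d ≤ ff a d * ff 2 e := by
      apply le_of_sq_le_sq _ (by positivity)
      rw [mul_pow, mul_pow, e1, e2, e3, e4]
      have : 0 ≤ (a ^ 2 - 4) * (e ^ 2 - d ^ 2) :=
        mul_nonneg (by nlinarith) (by nlinarith)
      nlinarith
    apply le_of_sq_le_sq _ (by positivity)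
    nlinarith
  have h3 : ff a d + ff a d ≤ ff (a + b - 2) d + ff 2 d := by
    have e2 : ff 2 d ^ 2 = 2 ^ 2 + d ^ 2 := Real.sq_sqrt (by positivity)
    have e3 : ff a d ^ 2 = a ^ 2 + d ^ 2 := Real.sq_sqrt (by positivity)
    have e4 : ff (a + b - 2) d ^ 2 = (a + b - 2) ^ 2 + d ^ 2 := Real.sq_sqrt (by positivity)
    have p2 : 0 ≤ ff 2 d := Real.sqrt_nonneg _
    have p3 : 0 ≤ ff a d := Real.sqrt_nonneg _
    have p4 : 0 ≤ ff (a + b - 2) d := Real.sqrt_nonneg _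
    have h : 2 * (a + b - 2) + d ^ 2 ≤ ff (a + b - 2) d * ff 2 d := by
      apply le_of_sq_le_sq _ (by positivity)
      rw [mul_pow, e2, e4]
      nlinarith [sq_nonneg (d * (a + b - 2 - 2))]
    apply le_of_sq_le_sq _ (by positivity)
    nlinarith
  linarith

noncomputable def FF {V : Type*} (d : V → ℝ) : Sym2 V → ℝ :=
  Sym2.lift ⟨fun a b => ff (d a) (d b), fun _ _ => ff_comm _ _⟩

lemma sombor_eq {V : Type*} [Fintype V] (G : SimpleGraph V) [DecidableEq V] [DecidableRel G.Adj] :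
    somborIndex G = ∑ e ∈ G.edgeFinset, FF (fun v => (G.degree v : ℝ)) e := by
  unfold somborIndex FF ff
  dsimp only
  apply Finset.sum_congr
  · congr!
  · intro e _
    induction e using Sym2.ind with
    | _ p q =>
      simp only [Sym2.lift_mk]
      congr!

lemma no_tri {V : Type*} [Fintype V] (G : SimpleGraph V) (hG : Unicyclic G)
    (u x y v z : V) (c : G.Walk u u) (hc : c.IsCycle)
    (hx : s(u, x) ∈ c.edges) (hy : s(u, y) ∈ c.edges) (hxy : x ≠ y)
    (hv : v ∉ c.support) (huv : G.Adj u v) (huz : G.Adj u z) (hvz : G.Adj v z) : False := by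
  classical
  obtain ⟨w, hw, hwz⟩ : ∃ w, s(u, w) ∈ c.edges ∧ w ≠ z := by
    by_cases h : x = z
    · exact ⟨y, hy, fun h' => hxy (h.trans h'.symm)⟩
    · exact ⟨x, hx, h⟩
  have hwv : w ≠ v := fun h => hv (h ▸ c.snd_mem_support_of_mem_edges hw)
  have hadj : G.Adj u w := c.adj_of_mem_edges hw
  have hconn : (G.deleteEdges {s(u, w)}).Connected := by
    apply hG.1.connected_delete_edge_of_not_isBridge
    exact fun hb => hb.notMem_edges_of_isCycle hc hw
  have htree : (G.deleteEdges {s(u, w)}).IsTree := by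
    rw [isTree_iff_connected_and_card]
    refine ⟨hconn, ?_⟩
    have h2 := hG.2
    have h3 : (G.deleteEdges {s(u, w)}).edgeFinset = G.edgeFinset.erase s(u, w) := by
      ext e
      simp [and_comm]
    rw [Nat.card_eq_fintype_card, ← edgeFinset_card, h3, Nat.card_eq_fintype_card,
      Finset.card_erase_add_one (by simpa using hadj)]
    convert h2
  have huv' : (G.deleteEdges {s(u, w)}).Adj u v := by
    rw [deleteEdges_adj]; refine ⟨huv, ?_⟩; simp; grind
  have huz' : (G.deleteEdges {s(u, w)}).Adj z u := by
    rw [deleteEdges_adj]; refine ⟨huz.symm, ?_⟩; simp; grind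
  have hvz' : (G.deleteEdges {s(u, w)}).Adj v z := by
    rw [deleteEdges_adj]; refine ⟨hvz, ?_⟩; have := huv.ne; have := huz.ne; simp; grind
  apply htree.isAcyclic (Walk.cons huv' (Walk.cons hvz' (Walk.cons huz' Walk.nil)))
  have := huv.ne; have := huz.ne; have := hvz.ne
  rw [Walk.cons_isCycle_iff]
  simp
  grind

set_option maxHeartbeats 2000000 in
/-- Lemma 3.4(b): `u` is on the cycle with cycle-neighbours `x, y` where
`deg y ≥ deg x`, the tree attached to `u` through `v` has `v` as its only
vertex of degree `≥ 3`, and `deg v > deg u`.  Moving the branches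
`u₁, …, u_n` of `u` together with the cycle edge `u x` over to `v`
strictly increases the Sombor index. -/
theorem sombor_unicyclic_shift_b {V : Type*} [Fintype V]
    (G : SimpleGraph V) [DecidableRel G.Adj] (hG : Unicyclic G)
    (u x y v : V) (c : G.Walk u u) (hc : c.IsCycle)
    (hx : s(u, x) ∈ c.edges) (hy : s(u, y) ∈ c.edges) (hxy : x ≠ y)
    (hyx : G.degree x ≤ G.degree y)
    (hv : v ∉ c.support) (huv : G.Adj u v) (hdv3 : 3 ≤ G.degree v)
    (honly : ∀ z : V, (G.deleteEdges {s(u, v)}).Reachable v z → 3 ≤ G.degree z → z = v)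
    (n m : ℕ)
    (U : Fin n → V) (hUinj : Function.Injective U)
    (hU : G.neighborSet u = {x, y, v} ∪ Set.range U) (hdu : G.degree u = n + 3)
    (W : Fin m → V) (hWinj : Function.Injective W)
    (hW : G.neighborSet v = {u} ∪ Set.range W) (hdv : G.degree v = m + 1)
    (hduv : G.degree u < G.degree v)
    (G' : SimpleGraph V)
    (hG' : G'.edgeSet =
      (G.edgeSet \ ({e | ∃ i : Fin n, e = s(u, U i)} ∪ {s(u, x)})) ∪
        ({e | ∃ i : Fin n, e = s(v, U i)} ∪ {s(v, x)})) :
    somborIndex G < somborIndex G' := by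
  classical
  have hxu : G.Adj u x := c.adj_of_mem_edges hx
  have hyu : G.Adj u y := c.adj_of_mem_edges hy
  obtain ⟨S, hS⟩ : ∃ S : Finset V, S = insert x (Finset.univ.image U) := ⟨_, rfl⟩
  have hxS : x ∈ S := by simp [hS]
  have hnb : G.neighborFinset u = insert y (insert v S) := by
    ext z
    have : z ∈ G.neighborSet u ↔ z ∈ ({x, y, v} ∪ Set.range U : Set V) := by rw [hU]
    simp only [mem_neighborSet, Set.mem_union, Set.mem_insert_iff, Set.mem_singleton_iff,
      Set.mem_range] at this
    simp only [mem_neighborFinset, hS, this, Finset.mem_insert, Finset.mem_image, Finset.mem_univ,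
      true_and]
    tauto
  have hcard : (insert y (insert v S)).card = n + 3 := by
    rw [← hnb, card_neighborFinset_eq_degree, hdu]
  have hScard : S.card ≤ n + 1 := by
    rw [hS]
    refine (Finset.card_insert_le _ _).trans ?_
    have := Finset.card_image_le (s := (Finset.univ : Finset (Fin n))) (f := U)
    simpa using this
  have hvS : v ∉ S := by
    intro h
    rw [Finset.insert_eq_of_mem h] at hcard
    have := Finset.card_insert_le y S
    omega
  have hyS : y ∉ insert v S := by
    intro h
    rw [Finset.insert_eq_of_mem h] at hcard
    have := Finset.card_insert_le v S
    omega
  rw [Finset.card_insert_of_notMem hyS, Finset.card_insert_of_notMem hvS] at hcard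
  have hScard' : S.card = n + 1 := by omega
  have hadju : ∀ z, G.Adj u z ↔ z = y ∨ z = v ∨ z ∈ S := by
    intro z
    rw [← mem_neighborFinset, hnb]; simp
  have hyv : y ≠ v := by rintro rfl; simp at hyS
  have hyS' : y ∉ S := by intro h; apply hyS; simp [h]
  have huS : u ∉ S := fun h => G.loopless.irrefl u ((hadju u).2 (Or.inr (Or.inr h)))
  have huv' := huv.ne
  have hyu' := hyu.ne
  have hSv : ∀ z ∈ S, ¬ G.Adj v z := fun z hz h =>
    no_tri G hG u x y v z c hc hx hy hxy hv huv ((hadju z).2 (Or.inr (Or.inr hz))) h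
  have hmem' : ∀ e, e ∈ G'.edgeSet ↔
      (e ∈ G.edgeSet ∧ ¬ ∃ s ∈ S, e = s(u, s)) ∨ ∃ s ∈ S, e = s(v, s) := by
    intro e
    have hw : ∀ w : V, (∃ s ∈ S, e = s(w, s)) ↔
        e ∈ ({e | ∃ i : Fin n, e = s(w, U i)} ∪ {s(w, x)} : Set (Sym2 V)) := by
      intro w
      constructor
      · rintro ⟨s, hs, rfl⟩
        rw [hS, Finset.mem_insert, Finset.mem_image] at hs
        rcases hs with rfl | ⟨i, -, rfl⟩
        · right; rfl
        · left; exact ⟨i, rfl⟩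
      · rintro (⟨i, rfl⟩ | rfl)
        · exact ⟨U i, by simp [hS], rfl⟩
        · exact ⟨x, hxS, rfl⟩
    rw [hG', hw u, hw v]
    rfl
  have hadj' : ∀ a b, G'.Adj a b ↔
      (G.Adj a b ∧ ¬ ∃ s ∈ S, s(a, b) = s(u, s)) ∨ ∃ s ∈ S, s(a, b) = s(v, s) := by
    intro a b
    rw [← mem_edgeSet, hmem', mem_edgeSet]
  have du' : 2 ≤ G'.degree u := by
    rw [← card_neighborFinset_eq_degree, ← Finset.card_pair hyv]
    apply Finset.card_le_card
    intro z hz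
    simp only [Finset.mem_insert, Finset.mem_singleton] at hz
    rw [mem_neighborFinset, hadj']
    left
    refine ⟨(hadju z).2 (by tauto), ?_⟩
    rintro ⟨s, hs, h⟩
    rw [Sym2.eq_iff] at h
    grind
  have dv' : G.degree u + G.degree v - 2 ≤ G'.degree v := by
    have hdis : Disjoint (G.neighborFinset v) S := by
      rw [Finset.disjoint_left]
      intro z hz hzS
      exact hSv z hzS (by simpa using hz)
    have : G.degree u + G.degree v - 2 = (G.neighborFinset v ∪ S).card := by
      rw [Finset.card_union_of_disjoint hdis, card_neighborFinset_eq_degree]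
      omega
    rw [this, ← card_neighborFinset_eq_degree]
    apply Finset.card_le_card
    intro z hz
    rw [mem_neighborFinset, hadj']
    rw [Finset.mem_union, mem_neighborFinset] at hz
    rcases hz with hz | hz
    · left
      refine ⟨hz, ?_⟩
      rintro ⟨s, hs, h⟩
      rw [Sym2.eq_iff] at h
      grind
    · right; exact ⟨z, hz, rfl⟩
  have dz' : ∀ z, z ≠ u → G.degree z ≤ G'.degree z := by
    intro z hzu
    rw [← card_neighborFinset_eq_degree, ← card_neighborFinset_eq_degree]
    by_cases hz : z ∈ S
    · have h1 : (insert v ((G.neighborFinset z).erase u)).card = (G.neighborFinset z).card := by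
        rw [Finset.card_insert_of_notMem, Finset.card_erase_add_one]
        · rw [mem_neighborFinset]; exact ((hadju z).2 (by tauto)).symm
        · intro h
          have := Finset.mem_of_mem_erase h
          rw [mem_neighborFinset] at this
          exact hSv z hz this.symm
      rw [← h1]
      apply Finset.card_le_card
      intro t ht
      rw [mem_neighborFinset, hadj']
      rw [Finset.mem_insert, Finset.mem_erase, mem_neighborFinset] at ht
      rcases ht with rfl | ⟨h1, h2⟩
      · right; exact ⟨z, hz, Sym2.eq_swap⟩
      · left
        refine ⟨h2, ?_⟩
        rintro ⟨s, hs, h⟩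
        rw [Sym2.eq_iff] at h
        grind
    · apply Finset.card_le_card
      intro t ht
      rw [mem_neighborFinset, hadj']
      rw [mem_neighborFinset] at ht
      left
      refine ⟨ht, ?_⟩
      rintro ⟨s, hs, h⟩
      rw [Sym2.eq_iff] at h
      grind
  obtain ⟨E0, hE0⟩ : ∃ E0 : Finset (Sym2 V), E0 = G.edgeFinset.filter (fun e => u ∉ e) := ⟨_, rfl⟩
  have hE0u : ∀ e ∈ E0, u ∉ e := by simp [hE0]
  have hne : s(u, v) ≠ s(u, y) := by
    intro h; rw [Sym2.eq_iff] at h; grind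
  have key : ∀ (H : Finset (Sym2 V)) (w : V) (g : Sym2 V → ℝ),
      H = S.image (fun s => s(w, s)) ∪ ({s(u, v), s(u, y)} ∪ E0) →
      Disjoint (S.image (fun s => s(w, s))) ({s(u, v), s(u, y)} ∪ E0) →
      ∑ e ∈ H, g e =
        ∑ s ∈ S, g s(w, s) + (g s(u, v) + g s(u, y) + ∑ e ∈ E0, g e) := by
    intro H w g h1 h2
    rw [h1, Finset.sum_union h2, Finset.sum_union, Finset.sum_pair hne, Finset.sum_image]
    · intro a _ b _ h
      exact Sym2.congr_right.1 h
    · rw [Finset.disjoint_left]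
      intro e he he'
      apply hE0u e he'
      simp only [Finset.mem_insert, Finset.mem_singleton] at he
      rcases he with rfl | rfl <;> simp
  have d1 : Disjoint (S.image (fun s => s(u, s))) ({s(u, v), s(u, y)} ∪ E0) := by
    rw [Finset.disjoint_left]
    intro e he he'
    rw [Finset.mem_image] at he
    obtain ⟨s, hs, rfl⟩ := he
    rw [Finset.mem_union] at he'
    rcases he' with h | h
    · simp only [Finset.mem_insert, Finset.mem_singleton, Sym2.eq_iff] at h
      grind
    · exact hE0u _ h (by simp)
  have d2 : Disjoint (S.image (fun s => s(v, s))) ({s(u, v), s(u, y)} ∪ E0) := by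
    rw [Finset.disjoint_left]
    intro e he he'
    rw [Finset.mem_image] at he
    obtain ⟨s, hs, rfl⟩ := he
    rw [Finset.mem_union] at he'
    rcases he' with h | h
    · simp only [Finset.mem_insert, Finset.mem_singleton, Sym2.eq_iff] at h
      grind
    · rw [hE0, Finset.mem_filter, mem_edgeFinset, mem_edgeSet] at h
      exact hSv s hs h.1
  have e1 : G.edgeFinset = S.image (fun s => s(u, s)) ∪ ({s(u, v), s(u, y)} ∪ E0) := by
    ext e
    simp only [hE0, Finset.mem_union, Finset.mem_image, Finset.mem_insert, Finset.mem_singleton,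
      Finset.mem_filter, mem_edgeFinset]
    constructor
    · intro h
      by_cases hu : u ∈ e
      · obtain ⟨z, rfl⟩ := hu
        rw [mem_edgeSet, hadju] at h
        rcases h with rfl | rfl | h
        · simp
        · simp
        · left; exact ⟨z, h, rfl⟩
      · tauto
    · rintro (⟨s, hs, rfl⟩ | (rfl | rfl) | h)
      · exact (hadju s).2 (by tauto)
      · exact huv
      · exact hyu
      · exact h.1
  have e2 : G'.edgeFinset = S.image (fun s => s(v, s)) ∪ ({s(u, v), s(u, y)} ∪ E0) := by
    ext e
    have h1 := (Finset.ext_iff (s₁ := G.edgeFinset)).1 e1 e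
    have h2 := fun hh => (Finset.disjoint_left.1 d1) (show e ∈ _ from hh)
    rw [mem_edgeFinset] at h1
    rw [mem_edgeFinset, hmem', h1]
    have h3 : (∃ s ∈ S, e = s(u, s)) ↔ e ∈ S.image (fun s => s(u, s)) := by
      simp [eq_comm]
    have h4 : (∃ s ∈ S, e = s(v, s)) ↔ e ∈ S.image (fun s => s(v, s)) := by
      simp [eq_comm]
    rw [h3, h4]
    generalize S.image (fun s => s(v, s)) = A at *
    generalize S.image (fun s => s(u, s)) = B at *
    generalize ({s(u, v), s(u, y)} ∪ E0 : Finset (Sym2 V)) = C at *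
    rw [Finset.mem_union, Finset.mem_union]
    tauto
  rw [sombor_eq G, sombor_eq G', key _ u _ e1 d1, key _ v _ e2 d2]
  have hcast : (G.degree u : ℝ) + G.degree v - 2 ≤ G'.degree v := by
    have : G.degree u + G.degree v ≤ G'.degree v + 2 := by omega
    have : (G.degree u : ℝ) + G.degree v ≤ G'.degree v + 2 := by exact_mod_cast this
    linarith
  have ha : (3 : ℝ) ≤ G.degree u := by
    have : 3 ≤ G.degree u := by omega
    exact_mod_cast this
  have hb : (G.degree u : ℝ) < G.degree v := by exact_mod_cast hduv
  have hSsum : ∑ s ∈ S.erase x, FF (fun z => (G.degree z : ℝ)) s(u, s) ≤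
      ∑ s ∈ S.erase x, FF (fun z => (G'.degree z : ℝ)) s(v, s) := by
    apply Finset.sum_le_sum
    intro s hs
    have hs' := Finset.mem_of_mem_erase hs
    apply ff_mono (by positivity) (by positivity)
    · linarith
    · exact Nat.cast_le.2 (dz' s (by rintro rfl; exact huS hs'))
  have hE0sum : ∑ e ∈ E0, FF (fun z => (G.degree z : ℝ)) e ≤
      ∑ e ∈ E0, FF (fun z => (G'.degree z : ℝ)) e := by
    apply Finset.sum_le_sum
    intro e he
    have hu := hE0u e he
    induction e using Sym2.ind with
    | _ p q =>
      rw [Sym2.mem_iff] at hu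
      apply ff_mono (by positivity) (by positivity)
      · exact Nat.cast_le.2 (dz' p (by grind))
      · exact Nat.cast_le.2 (dz' q (by grind))
  rw [← Finset.add_sum_erase S _ hxS, ← Finset.add_sum_erase S _ hxS]
  have hnum := ff_num (G.degree u) (G.degree v) (G.degree x) (G.degree y) ha hb (by positivity)
    (by exact_mod_cast hyx)
  have k1 : ff (G.degree u + G.degree v - 2) (G.degree x) ≤
      FF (fun z => (G'.degree z : ℝ)) s(v, x) := by
    apply ff_mono (by linarith) (by positivity) hcast
    exact Nat.cast_le.2 (dz' x hxu.ne.symm)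
  have k2 : ff 2 (G.degree y) ≤ FF (fun z => (G'.degree z : ℝ)) s(u, y) := by
    apply ff_mono (by norm_num) (by positivity)
    · exact Nat.ofNat_le_cast.2 du'
    · exact Nat.cast_le.2 (dz' y hyu.ne.symm)
  have k3 : ff 2 (G.degree u + G.degree v - 2) ≤ FF (fun z => (G'.degree z : ℝ)) s(u, v) := by
    apply ff_mono (by norm_num) (by linarith) _ hcast
    exact Nat.ofNat_le_cast.2 du'
  have j1 : FF (fun z => (G.degree z : ℝ)) s(u, x) = ff (G.degree u) (G.degree x) := rfl
  have j2 : FF (fun z => (G.degree z : ℝ)) s(u, y) = ff (G.degree u) (G.degree y) := rfl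
  have j3 : FF (fun z => (G.degree z : ℝ)) s(u, v) = ff (G.degree u) (G.degree v) := rfl
  linarith
end

section
/- Let G be a unicyclic graph whose cycle C_l has length l ≥ 4, and let x ~ u ~ v ~ y be consecutive vertices on the cycle such that the trees attached to u and to v are (nonempty collections of) paths; write N(u) = {x, v} ∪ {u₁,…,u_n} and N(v) = {u, y} ∪ {v₁,…,v_m} with n, m ≥ 1. Let z be a pendant end-vertex of one of the paths attached to u or to v, and let G* be the graph obtained from G by deleting the edge u v, merging the vertices u and v into a single vertex (adjacent to x, y, u₁,…,u_n, v₁,…,v_m), and attaching one new pendant vertex to z. Then SO(G*) > SO(G). -/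
open SimpleGraph

namespace SomborAux

/-- Edge weight with respect to an arbitrary real vertex weight. -/
noncomputable def wt {V : Type*} (D : V → ℝ) (e : Sym2 V) : ℝ :=
  Sym2.lift ⟨fun a b => Real.sqrt (D a ^ 2 + D b ^ 2), fun a b => by simp [add_comm]⟩ e

lemma wt_mk {V : Type*} (D : V → ℝ) (a b : V) :
    wt D s(a, b) = Real.sqrt (D a ^ 2 + D b ^ 2) := rfl

lemma wt_nonneg {V : Type*} (D : V → ℝ) (e : Sym2 V) : 0 ≤ wt D e := by
  induction e using Sym2.ind with
  | _ a b => rw [wt_mk]; positivity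

lemma wt_mono {V : Type*} (D D' : V → ℝ) (h0 : ∀ t, 0 ≤ D t) (h : ∀ t, D t ≤ D' t)
    (e : Sym2 V) : wt D e ≤ wt D' e := by
  induction e using Sym2.ind with
  | _ a b =>
    rw [wt_mk, wt_mk]
    have h1 := h0 a
    have h2 := h0 b
    have h3 := h a
    have h4 := h b
    gcongr

lemma wt_map {V : Type*} (D : V → ℝ) (f : V → V) (e : Sym2 V) :
    wt D (Sym2.map f e) = wt (D ∘ f) e := by
  induction e using Sym2.ind with
  | _ a b => rfl

lemma sombor_eq {V : Type*} [Fintype V] (G : SimpleGraph V) [DecidableEq V]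
    [DecidableRel G.Adj] :
    somborIndex G = ∑ e ∈ G.edgeFinset, wt (fun t => (G.degree t : ℝ)) e := by
  unfold somborIndex wt
  congr!

lemma four_sqrt (a b d e : ℝ) (ha : 0 ≤ a) (hab : a ≤ b) (hd : 0 ≤ d) (hde : d ≤ e) :
    √(b ^ 2 + e ^ 2) - √(a ^ 2 + e ^ 2) ≤ √(b ^ 2 + d ^ 2) - √(a ^ 2 + d ^ 2) := by
  have h1 : √(a ^ 2 + d ^ 2) * √(b ^ 2 + e ^ 2) ≤ √(b ^ 2 + d ^ 2) * √(a ^ 2 + e ^ 2) := by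
    rw [← Real.sqrt_mul (by positivity), ← Real.sqrt_mul (by positivity)]
    apply Real.sqrt_le_sqrt
    have : 0 ≤ (e ^ 2 - d ^ 2) * (b ^ 2 - a ^ 2) := by
      apply mul_nonneg <;> nlinarith
    nlinarith
  have h2 : √(a ^ 2 + d ^ 2) + √(b ^ 2 + e ^ 2) ≤ √(b ^ 2 + d ^ 2) + √(a ^ 2 + e ^ 2) := by
    apply (sq_le_sq₀ (by positivity) (by positivity)).1
    · have e1 := Real.sq_sqrt (show 0 ≤ a ^ 2 + d ^ 2 by positivity)
      have e2 := Real.sq_sqrt (show 0 ≤ b ^ 2 + d ^ 2 by positivity)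
      have e3 := Real.sq_sqrt (show 0 ≤ a ^ 2 + e ^ 2 by positivity)
      have e4 := Real.sq_sqrt (show 0 ≤ b ^ 2 + e ^ 2 by positivity)
      nlinarith
  linarith

lemma slope (a h : ℝ) (ha : 3 ≤ a) (hh : 0 ≤ h) :
    √(a ^ 2 + 2 ^ 2) + (4 / 5) * h ≤ √((a + h) ^ 2 + 2 ^ 2) := by
  apply Real.le_sqrt_of_sq_le
  have e1 := Real.sq_sqrt (show 0 ≤ a ^ 2 + 2 ^ 2 by positivity)
  have e2 : √(a ^ 2 + 2 ^ 2) ≤ (5 / 4) * a := by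
    rw [Real.sqrt_le_left (by linarith)]
    nlinarith
  have e3 := mul_le_mul_of_nonneg_left e2 hh
  generalize √(a ^ 2 + 2 ^ 2) = r at *
  nlinarith [sq_nonneg h]

lemma final_ineq (n m : ℕ) (hn : 1 ≤ n) (hm : 1 ≤ m) :
    √(((n : ℝ) + 2) ^ 2 + ((m : ℝ) + 2) ^ 2) <
      n * (√(((n : ℝ) + m + 2) ^ 2 + 2 ^ 2) - √(((n : ℝ) + 2) ^ 2 + 2 ^ 2))
      + m * (√(((n : ℝ) + m + 2) ^ 2 + 2 ^ 2) - √(((m : ℝ) + 2) ^ 2 + 2 ^ 2))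
      + (√(2 ^ 2 + ((n : ℝ) + m + 2) ^ 2) - √(1 ^ 2 + ((n : ℝ) + m + 2) ^ 2))
      + √(2 ^ 2 + 1 ^ 2) := by
  by_cases hk : n = 1 ∧ m = 1
  · obtain ⟨rfl, rfl⟩ := hk
    norm_num
    have a1 : √18 < 4.243 := by rw [Real.sqrt_lt' (by norm_num)]; norm_num
    have a2 : √13 < 3.606 := by rw [Real.sqrt_lt' (by norm_num)]; norm_num
    have a3 : √17 < 4.124 := by rw [Real.sqrt_lt' (by norm_num)]; norm_num
    have a4 : 4.472 < √20 := by rw [Real.lt_sqrt (by norm_num)]; norm_num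
    have a5 : 2.236 < √5 := by rw [Real.lt_sqrt (by norm_num)]; norm_num
    linarith
  · have hn' : (1 : ℝ) ≤ n := by exact_mod_cast hn
    have hm' : (1 : ℝ) ≤ m := by exact_mod_cast hm
    have hs : (3 : ℝ) ≤ n + m := by
      have : 3 ≤ n + m := by omega
      exact_mod_cast this
    have s1 := slope (n + 2) m (by linarith) (by linarith)
    have s2 := slope (m + 2) n (by linarith) (by linarith)
    rw [show (n : ℝ) + 2 + m = n + m + 2 by ring] at s1
    rw [show (m : ℝ) + 2 + n = n + m + 2 by ring] at s2
    have t1 := mul_le_mul_of_nonneg_left (sub_nonneg.2 s1) (by linarith : (0 : ℝ) ≤ n)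
    have t2 := mul_le_mul_of_nonneg_left (sub_nonneg.2 s2) (by linarith : (0 : ℝ) ≤ m)
    have a3 : √(1 ^ 2 + ((n : ℝ) + m + 2) ^ 2) ≤ √(2 ^ 2 + ((n : ℝ) + m + 2) ^ 2) := by
      apply Real.sqrt_le_sqrt
      norm_num
    have a5 : 11 / 5 < √(2 ^ 2 + 1 ^ 2) := by rw [Real.lt_sqrt (by norm_num)]; norm_num
    have key : √(((n : ℝ) + 2) ^ 2 + ((m : ℝ) + 2) ^ 2) < (8 / 5) * (n * m) + 11 / 5 := by
      rw [Real.sqrt_lt' (by positivity)]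
      have k1 : (n : ℝ) + m ≤ n * m + 1 := by nlinarith
      have k2 : (2 : ℝ) ≤ n * m := by linarith
      have k3 : (n : ℝ) ^ 2 + m ^ 2 ≤ (n * m) ^ 2 + 1 := by
        have : 0 ≤ ((n : ℝ) ^ 2 - 1) * (m ^ 2 - 1) := by apply mul_nonneg <;> nlinarith
        nlinarith
      generalize (n : ℝ) * m = k at *
      nlinarith
    generalize √(((n : ℝ) + m + 2) ^ 2 + 2 ^ 2) = r1 at *
    generalize √(((n : ℝ) + 2) ^ 2 + 2 ^ 2) = r2 at *
    generalize √(((m : ℝ) + 2) ^ 2 + 2 ^ 2) = r3 at *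
    generalize √(2 ^ 2 + ((n : ℝ) + m + 2) ^ 2) = r4 at *
    generalize √(1 ^ 2 + ((n : ℝ) + m + 2) ^ 2) = r5 at *
    generalize √(((n : ℝ) + 2) ^ 2 + ((m : ℝ) + 2) ^ 2) = r6 at *
    generalize √((2 : ℝ) ^ 2 + 1 ^ 2) = r7 at *
    have t1' : (0 : ℝ) ≤ n * (r1 - r2) - 4 / 5 * (n * m) := by
      have e : (n : ℝ) * (r1 - (r2 + 4 / 5 * m)) = n * (r1 - r2) - 4 / 5 * (n * m) := by ring
      linarith
    have t2' : (0 : ℝ) ≤ m * (r1 - r3) - 4 / 5 * (n * m) := by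
      have e : (m : ℝ) * (r1 - (r3 + 4 / 5 * n)) = m * (r1 - r3) - 4 / 5 * (n * m) := by ring
      linarith
    linarith

lemma no_common {V : Type*} [Fintype V]
    (G : SimpleGraph V) [DecidableRel G.Adj] (u v x y : V)
    (hxu : G.Adj x u) (hxv : x ≠ v) (hxy : x ≠ y) (huvne : u ≠ v)
    (hdu : 3 ≤ G.degree u) (hdv : 3 ≤ G.degree v)
    (hupath : ∀ t : V, (G.deleteEdges {s(x, u), s(u, v)}).Reachable u t → t ≠ u →
      G.degree t ≤ 2)
    (hvpath : ∀ t : V, (G.deleteEdges {s(u, v), s(v, y)}).Reachable v t → t ≠ v →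
      G.degree t ≤ 2) (t : V) (h1 : G.Adj u t) (h2 : G.Adj v t) : False := by
  have n1 := h1.ne
  have n2 := h2.ne
  by_cases htx : t = x
  · subst htx
    have r1 : (G.deleteEdges {s(u, v), s(v, y)}).Adj v t := by
      rw [deleteEdges_adj]
      refine ⟨h2, ?_⟩
      simp only [Set.mem_insert_iff, Set.mem_singleton_iff, Sym2.eq_iff]
      grind
    have r2 : (G.deleteEdges {s(u, v), s(v, y)}).Adj t u := by
      rw [deleteEdges_adj]
      refine ⟨h1.symm, ?_⟩
      simp only [Set.mem_insert_iff, Set.mem_singleton_iff, Sym2.eq_iff]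
      grind
    have := hvpath u (r1.reachable.trans r2.reachable) huvne
    omega
  · have r1 : (G.deleteEdges {s(x, u), s(u, v)}).Adj u t := by
      rw [deleteEdges_adj]
      refine ⟨h1, ?_⟩
      simp only [Set.mem_insert_iff, Set.mem_singleton_iff, Sym2.eq_iff]
      grind
    have r2 : (G.deleteEdges {s(x, u), s(u, v)}).Adj t v := by
      rw [deleteEdges_adj]
      refine ⟨h2.symm, ?_⟩
      simp only [Set.mem_insert_iff, Set.mem_singleton_iff, Sym2.eq_iff]
      grind
    have := hupath v (r1.reachable.trans r2.reachable) huvne.symm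
    omega

/-- The last vertex before `z` on a walk from `u`. -/
lemma last_step {V : Type*} (H : SimpleGraph V) (u z : V) (h : H.Reachable u z) (hne : z ≠ u) :
    ∃ w, H.Reachable u w ∧ H.Adj w z := by
  obtain ⟨p⟩ := h.symm
  cases p with
  | nil => exact absurd rfl hne
  | cons h q => exact ⟨_, q.reachable.symm, h.symm⟩

lemma deg_bound {V : Type*} [Fintype V] (G : SimpleGraph V) [DecidableRel G.Adj] (u a b : V)
    (hpath : ∀ t : V, (G.deleteEdges {s(a, u), s(u, b)}).Reachable u t → t ≠ u →
      G.degree t ≤ 2) (t : V) (h : G.Adj u t) (hta : t ≠ a) (htb : t ≠ b) : G.degree t ≤ 2 := by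
  refine hpath t (Adj.reachable ?_) h.ne'
  rw [deleteEdges_adj]
  refine ⟨h, ?_⟩
  have := h.ne
  simp only [Set.mem_insert_iff, Set.mem_singleton_iff, Sym2.eq_iff]
  grind

/-- Abstract counting core. -/
lemma core {V : Type*} [Fintype V] [DecidableEq V]
    (G G' : SimpleGraph V) [DecidableRel G.Adj] [DecidableRel G'.Adj]
    (u v x y z w : V) (huv : G.Adj u v) (hxu : G.Adj u x) (hvy : G.Adj v y)
    (hxv : x ≠ v) (hyu : y ≠ u)
    (n m : ℕ) (hn : 1 ≤ n) (hm : 1 ≤ m)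
    (hdu : G.degree u = n + 2) (hdv : G.degree v = m + 2)
    (hcom : ∀ t, G.Adj u t → G.Adj v t → False)
    (hdU : ∀ t, G.Adj u t → t ≠ x → t ≠ v → G.degree t ≤ 2)
    (hdW : ∀ t, G.Adj v t → t ≠ u → t ≠ y → G.degree t ≤ 2)
    (hz1 : G.degree z = 1) (hwz : G.Adj w z) (hw : w = u ∨ w = v ∨ G.degree w ≤ 2)
    (h1 : ∀ a b, a ≠ v → b ≠ v → G.Adj a b → G'.Adj a b)
    (h2 : ∀ b, b ≠ u → G.Adj v b → G'.Adj u b)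
    (h3 : G'.Adj z v) :
    somborIndex G < somborIndex G' := by
  have huvne := huv.ne
  have hzu : z ≠ u := by rintro rfl; omega
  have hzv : z ≠ v := by rintro rfl; omega
  -- the merging map
  let π : V → V := fun t => if t = v then u else t
  have hπ : ∀ a b, s(a, b) ≠ s(u, v) → G.Adj a b → G'.Adj (π a) (π b) := by
    intro a b hne hab
    have hab' := hab.ne
    simp only [π]
    rw [Ne, Sym2.eq_iff] at hne
    split_ifs with ha hb hb
    · grind
    · subst ha; exact h2 b (by grind) hab
    · subst hb; exact (h2 a (by grind) hab.symm).symm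
    · exact h1 a b ha hb hab
  have hinj : Set.InjOn (Sym2.map π) ((G.edgeFinset.erase s(u, v) : Finset (Sym2 V)) : Set (Sym2 V)) := by
    intro e he e' he' hee
    induction e using Sym2.ind with
    | _ a b =>
    induction e' using Sym2.ind with
    | _ c d =>
    simp only [Finset.coe_erase, Set.mem_sdiff, Finset.mem_coe, mem_edgeFinset, mem_edgeSet,
      Set.mem_singleton_iff, Sym2.eq_iff] at he he'
    simp only [Sym2.map_mk, Sym2.eq_iff, π] at hee ⊢
    have := he.1.ne
    have := he'.1.ne
    have hs1 := he.1.symm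
    have hs2 := he'.1.symm
    have hs3 := he.1
    have hs4 := he'.1
    clear hπ h1 h2 h3 hdU hdW hwz hw hz1 hdu hdv hxu hvy hxv hyu
    grind
  -- degrees in the new graph
  have hdeg : ∀ t, t ≠ u → t ≠ v → G.degree t ≤ G'.degree t := by
    intro t htu htv
    rw [← card_neighborFinset_eq_degree, ← card_neighborFinset_eq_degree]
    apply Finset.card_le_card_of_injOn π
    · intro a ha
      simp only [Finset.mem_coe, mem_neighborFinset] at ha ⊢
      have := hπ t a (by rw [Ne, Sym2.eq_iff]; grind) ha
      simpa [π, htv] using this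
    · intro a ha b hb hab
      simp only [Finset.mem_coe, mem_neighborFinset] at ha hb
      have := ha.symm
      have := hb.symm
      simp only [π] at hab
      clear hπ h1 h2 h3 hdU hdW hwz hw hz1 hdu hdv hxu hvy hxv hyu hinj
      grind
  have hdz : 2 ≤ G'.degree z := by
    have hw' : π w ≠ v := by simp only [π]; grind
    have : G'.Adj z (π w) := by
      have := hπ z w (by rw [Ne, Sym2.eq_iff]; grind) hwz.symm
      simpa [π, hzv] using this
    rw [← card_neighborFinset_eq_degree, ← Finset.card_pair hw']
    apply Finset.card_le_card
    intro a ha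
    simp only [Finset.mem_insert, Finset.mem_singleton] at ha
    rw [mem_neighborFinset]
    rcases ha with rfl | rfl <;> assumption
  have hdv' : 1 ≤ G'.degree v := by
    rw [Nat.one_le_iff_ne_zero, ← Nat.pos_iff_ne_zero, degree_pos_iff_exists_adj]
    exact ⟨z, h3.symm⟩
  have hdu' : n + m + 2 ≤ G'.degree u := by
    have e1 : ((G.neighborFinset u).erase v).card = n + 1 := by
      rw [Finset.card_erase_of_mem (by simpa using huv), card_neighborFinset_eq_degree]; omega
    have e2 : ((G.neighborFinset v).erase u).card = m + 1 := by
      rw [Finset.card_erase_of_mem (by simpa using huv.symm), card_neighborFinset_eq_degree]; omega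
    have e3 : Disjoint ((G.neighborFinset u).erase v) ((G.neighborFinset v).erase u) := by
      rw [Finset.disjoint_left]
      intro a ha hb
      simp only [Finset.mem_erase, mem_neighborFinset] at ha hb
      exact hcom a ha.2 hb.2
    have e4 := Finset.card_union_of_disjoint e3
    rw [← card_neighborFinset_eq_degree]
    refine le_trans (by omega : n + m + 2 ≤ _) (Finset.card_le_card (s :=
      ((G.neighborFinset u).erase v) ∪ ((G.neighborFinset v).erase u)) ?_)
    intro a ha
    simp only [Finset.mem_union, Finset.mem_erase, mem_neighborFinset] at ha ⊢
    rcases ha with ha | ha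
    · exact h1 u a huvne ha.1 ha.2
    · exact h2 a ha.1 ha.2
  -- weights
  let d : V → ℝ := fun t => (G.degree t : ℝ)
  let d' : V → ℝ := fun t => (G'.degree t : ℝ)
  let s : ℝ := (n : ℝ) + m + 2
  let D1 : V → ℝ := fun t => if t = u ∨ t = v then s else d t
  let D2 : V → ℝ := d' ∘ π
  have hd0 : ∀ t, 0 ≤ d t := fun t => Nat.cast_nonneg _
  have hd0' : ∀ t, 0 ≤ d' t := fun t => Nat.cast_nonneg _
  have hdu_r : d u = n + 2 := by simp only [d, hdu]; push_cast; ring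
  have hdv_r : d v = m + 2 := by simp only [d, hdv]; push_cast; ring
  have hn' : (1 : ℝ) ≤ n := by exact_mod_cast hn
  have hm' : (1 : ℝ) ≤ m := by exact_mod_cast hm
  have hs0 : 0 ≤ s := by positivity
  have hD1u : D1 u = s := by simp [D1]
  have hD1v : D1 v = s := by simp [D1]
  have hD1o : ∀ t, t ≠ u → t ≠ v → D1 t = d t := by intro t a b; simp [D1, a, b]
  have hdD1 : ∀ t, d t ≤ D1 t := by
    intro t
    by_cases hu : t = u
    · subst hu; rw [hD1u, hdu_r]; simp only [s]; linarith
    by_cases hv : t = v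
    · subst hv; rw [hD1v, hdv_r]; simp only [s]; linarith
    rw [hD1o t hu hv]
  have hD10 : ∀ t, 0 ≤ D1 t := fun t => (hd0 t).trans (hdD1 t)
  have hsd' : s ≤ d' u := by
    simp only [s, d']
    exact_mod_cast hdu'
  have hD2o : ∀ t, t ≠ v → D2 t = d' t := by
    intro t ht
    exact congrArg d' (if_neg ht : π t = t)
  have hD12 : ∀ t, D1 t ≤ D2 t := by
    intro t
    by_cases hv : t = v
    · subst hv; rw [hD1v]; simpa [D2, π] using hsd'
    by_cases hu : t = u
    · subst hu; rw [hD1u]; simpa [D2, π, hv] using hsd'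
    rw [hD1o t hu hv]
    rw [hD2o t hv]
    simp only [d, d']
    exact_mod_cast hdeg t hu hv
  have hD2z : 2 ≤ D2 z := by
    rw [hD2o z hzv]
    simp only [d']
    exact_mod_cast hdz
  have hD1z : D1 z = 1 := by rw [hD1o z hzu hzv]; simp [d, hz1]
  have hD1w : D1 w ≤ s := by
    by_cases hu : w = u
    · rw [hu, hD1u]
    by_cases hv : w = v
    · rw [hv, hD1v]
    rw [hD1o w hu hv]
    have : G.degree w ≤ 2 := by tauto
    have : d w ≤ 2 := by simp only [d]; exact_mod_cast this
    simp only [s]; linarith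
  set E := G.edgeFinset.erase s(u, v) with hE
  have hmemE : ∀ a b, s(a, b) ∈ E ↔ s(a, b) ≠ s(u, v) ∧ G.Adj a b := by
    intro a b; simp [hE]
  -- SO(G)
  have hSO : somborIndex G = ∑ e ∈ E, wt d e + √(((n : ℝ) + 2) ^ 2 + ((m : ℝ) + 2) ^ 2) := by
    rw [sombor_eq, hE, Finset.sum_erase_eq_sub (by simpa using huv)]
    simp only [wt_mk]
    rw [← hdu_r, ← hdv_r]
    simp [d]
  -- index of the new graph
  have hSO' : ∑ e ∈ E, wt D2 e + √(2 ^ 2 + 1 ^ 2) ≤ somborIndex G' := by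
    rw [sombor_eq]
    have hnot : s(z, v) ∉ E.image (Sym2.map π) := by
      intro hmem
      obtain ⟨e, he, hee⟩ := Finset.mem_image.1 hmem
      induction e using Sym2.ind with
      | _ a b =>
      simp only [Sym2.map_mk, Sym2.eq_iff, π] at hee
      grind
    have hsub : insert s(z, v) (E.image (Sym2.map π)) ⊆ G'.edgeFinset := by
      intro e he
      rcases Finset.mem_insert.1 he with rfl | he
      · simpa using h3
      · obtain ⟨f, hf, rfl⟩ := Finset.mem_image.1 he
        induction f using Sym2.ind with
        | _ a b =>
        rw [hmemE] at hf
        simpa using hπ a b hf.1 hf.2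
    refine le_trans ?_ (Finset.sum_le_sum_of_subset_of_nonneg hsub
      (fun e _ _ => wt_nonneg _ e))
    rw [Finset.sum_insert hnot, Finset.sum_image hinj]
    have a1 : √(2 ^ 2 + 1 ^ 2) ≤ wt (fun t => (G'.degree t : ℝ)) s(z, v) := by
      rw [wt_mk]
      have b1 : (2 : ℝ) ≤ G'.degree z := by exact_mod_cast hdz
      have b2 : (1 : ℝ) ≤ G'.degree v := by exact_mod_cast hdv'
      gcongr
    have a2 : ∑ e ∈ E, wt D2 e = ∑ e ∈ E, wt (fun t => (G'.degree t : ℝ)) (Sym2.map π e) := by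
      apply Finset.sum_congr rfl
      intro e _
      rw [wt_map]
    linarith
  -- step 2
  have hstep2 : √(2 ^ 2 + s ^ 2) - √(1 ^ 2 + s ^ 2) ≤ ∑ e ∈ E, (wt D2 e - wt D1 e) := by
    have hmem : s(z, w) ∈ E := by
      rw [hmemE]; exact ⟨by rw [Ne, Sym2.eq_iff]; grind, hwz.symm⟩
    refine le_trans ?_ (Finset.single_le_sum
      (fun e _ => sub_nonneg.2 (wt_mono D1 D2 hD10 hD12 e)) hmem)
    rw [wt_mk, wt_mk, hD1z]
    have a1 := four_sqrt 1 2 (D1 w) s (by norm_num) (by norm_num) (hD10 w) hD1w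
    have a2 : √(2 ^ 2 + D1 w ^ 2) ≤ √(D2 z ^ 2 + D2 w ^ 2) := by
      have := hD12 w
      have := hD10 w
      gcongr
    linarith
  -- step 1
  have hstep1 : n * (√(s ^ 2 + 2 ^ 2) - √(((n : ℝ) + 2) ^ 2 + 2 ^ 2))
      + m * (√(s ^ 2 + 2 ^ 2) - √(((m : ℝ) + 2) ^ 2 + 2 ^ 2))
      ≤ ∑ e ∈ E, (wt D1 e - wt d e) := by
    let Su := ((G.neighborFinset u).erase v).erase x
    let Sv := ((G.neighborFinset v).erase u).erase y
    have cu : Su.card = n := by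
      rw [Finset.card_erase_of_mem (by simp [hxu, hxv]),
        Finset.card_erase_of_mem (by simpa using huv), card_neighborFinset_eq_degree]; omega
    have cv : Sv.card = m := by
      rw [Finset.card_erase_of_mem (by simp [hvy, hyu]),
        Finset.card_erase_of_mem (by simpa using huv.symm), card_neighborFinset_eq_degree]; omega
    have mu : ∀ t, t ∈ Su ↔ t ≠ x ∧ t ≠ v ∧ G.Adj u t := by intro t; simp [Su]
    have mv : ∀ t, t ∈ Sv ↔ t ≠ y ∧ t ≠ u ∧ G.Adj v t := by intro t; simp [Sv]
    have iu : Set.InjOn (fun t => s(u, t)) (Su : Set V) := by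
      intro a _ b _ h; exact Sym2.congr_right.1 h
    have iv : Set.InjOn (fun t => s(v, t)) (Sv : Set V) := by
      intro a _ b _ h; exact Sym2.congr_right.1 h
    have hdisj : Disjoint (Su.image (fun t => s(u, t))) (Sv.image (fun t => s(v, t))) := by
      rw [Finset.disjoint_left]
      intro e he he'
      obtain ⟨a, ha, rfl⟩ := Finset.mem_image.1 he
      obtain ⟨b, hb, hab⟩ := Finset.mem_image.1 he'
      rw [mu] at ha
      rw [mv] at hb
      simp only [Sym2.eq_iff] at hab
      grind
    have hsub : (Su.image (fun t => s(u, t))) ∪ (Sv.image (fun t => s(v, t))) ⊆ E := by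
      intro e he
      rcases Finset.mem_union.1 he with he | he
      · obtain ⟨a, ha, rfl⟩ := Finset.mem_image.1 he
        rw [mu] at ha
        rw [hmemE]
        exact ⟨by rw [Ne, Sym2.eq_iff]; grind, ha.2.2⟩
      · obtain ⟨a, ha, rfl⟩ := Finset.mem_image.1 he
        rw [mv] at ha
        rw [hmemE]
        exact ⟨by rw [Ne, Sym2.eq_iff]; grind, ha.2.2⟩
    refine le_trans ?_ (Finset.sum_le_sum_of_subset_of_nonneg hsub
      (fun e _ _ => sub_nonneg.2 (wt_mono d D1 hd0 hdD1 e)))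
    rw [Finset.sum_union hdisj, Finset.sum_image iu, Finset.sum_image iv]
    apply add_le_add
    · rw [← nsmul_eq_mul, ← cu]
      apply Finset.card_nsmul_le_sum
      intro t ht
      rw [mu] at ht
      have dt : d t ≤ 2 := by
        simp only [d]; exact_mod_cast hdU t ht.2.2 ht.1 ht.2.1
      rw [wt_mk, wt_mk, hD1u, hdu_r, hD1o t ht.2.2.ne' ht.2.1, cu]
      exact four_sqrt _ _ _ _ (by positivity) (by simp only [s]; linarith) (hd0 t) dt
    · rw [← nsmul_eq_mul, ← cv]
      apply Finset.card_nsmul_le_sum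
      intro t ht
      rw [mv] at ht
      have dt : d t ≤ 2 := by
        simp only [d]; exact_mod_cast hdW t ht.2.2 ht.2.1 ht.1
      rw [wt_mk, wt_mk, hD1v, hdv_r, hD1o t ht.2.1 ht.2.2.ne', cv]
      exact four_sqrt _ _ _ _ (by positivity) (by simp only [s]; linarith) (hd0 t) dt
  have hfin := final_ineq n m hn hm
  rw [Finset.sum_sub_distrib] at hstep1 hstep2
  simp only [s] at hstep1 hstep2
  linarith

end SomborAux

/-- Lemma 3.6: `x ~ u ~ v ~ y` are consecutive vertices on the cycle (of length
`≥ 4`) of a unicyclic graph, the trees attached to `u` and to `v` are nonempty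
collections of paths, and `z` is a pendant end-vertex of one of these paths.
Contracting the edge `u v` (merging `u` and `v`, here realised by re-attaching
all edges at `v` to `u`) and attaching a new pendant vertex (here the freed
vertex `v`) to `z` strictly increases the Sombor index. -/
theorem sombor_contract_cycle_edge {V : Type*} [Fintype V]
    (G : SimpleGraph V) [DecidableRel G.Adj] (hG : Unicyclic G)
    (u v x y z : V) (c : G.Walk u u) (hc : c.IsCycle) (hclen : 4 ≤ c.length)
    (hxu : s(x, u) ∈ c.edges) (huv : s(u, v) ∈ c.edges) (hvy : s(v, y) ∈ c.edges)
    (hxv : x ≠ v) (hyu : y ≠ u) (hxy : x ≠ y) (huvne : u ≠ v)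
    (n m : ℕ) (hn : 1 ≤ n) (hm : 1 ≤ m)
    (U : Fin n → V) (hUinj : Function.Injective U)
    (hU : G.neighborSet u = {x, v} ∪ Set.range U) (hdu : G.degree u = n + 2)
    (W : Fin m → V) (hWinj : Function.Injective W)
    (hW : G.neighborSet v = {u, y} ∪ Set.range W) (hdv : G.degree v = m + 2)
    (hupath : ∀ t : V, (G.deleteEdges {s(x, u), s(u, v)}).Reachable u t → t ≠ u →
      G.degree t ≤ 2)
    (hvpath : ∀ t : V, (G.deleteEdges {s(u, v), s(v, y)}).Reachable v t → t ≠ v →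
      G.degree t ≤ 2)
    (hz1 : G.degree z = 1)
    (hz : (G.deleteEdges {s(x, u), s(u, v)}).Reachable u z ∨
      (G.deleteEdges {s(u, v), s(v, y)}).Reachable v z)
    (G' : SimpleGraph V)
    (hG' : G'.edgeSet =
      (G.edgeSet \ ({s(u, v), s(v, y)} ∪ {e | ∃ j : Fin m, e = s(v, W j)})) ∪
        ({s(u, y)} ∪ {e | ∃ j : Fin m, e = s(u, W j)} ∪ {s(z, v)})) :
    somborIndex G < somborIndex G' := by
  classical
  have adj_xu : G.Adj x u := c.adj_of_mem_edges hxu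
  have adj_uv : G.Adj u v := c.adj_of_mem_edges huv
  have adj_vy : G.Adj v y := c.adj_of_mem_edges hvy
  have hcom := SomborAux.no_common G u v x y adj_xu hxv hxy huvne (by omega) (by omega)
    hupath hvpath
  have hzu : z ≠ u := by rintro rfl; omega
  have hzv : z ≠ v := by rintro rfl; omega
  have hw : ∃ w, G.Adj w z ∧ (w = u ∨ w = v ∨ G.degree w ≤ 2) := by
    rcases hz with hz | hz
    · obtain ⟨w, hr, ha⟩ := SomborAux.last_step _ u z hz hzu
      refine ⟨w, (deleteEdges_adj.1 ha).1, ?_⟩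
      by_cases h : w = u
      · exact Or.inl h
      · exact Or.inr (Or.inr (hupath w hr h))
    · obtain ⟨w, hr, ha⟩ := SomborAux.last_step _ v z hz hzv
      refine ⟨w, (deleteEdges_adj.1 ha).1, ?_⟩
      by_cases h : w = v
      · exact Or.inr (Or.inl h)
      · exact Or.inr (Or.inr (hvpath w hr h))
  obtain ⟨w, hwz, hw⟩ := hw
  have hadj : ∀ a b, G'.Adj a b ↔ s(a, b) ∈ G'.edgeSet := fun a b => Iff.rfl
  refine SomborAux.core G G' u v x y z w adj_uv adj_xu.symm adj_vy hxv hyu n m hn hm hdu hdv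
    hcom (fun t h1 h2 h3 => SomborAux.deg_bound G u x v hupath t h1 h2 h3)
    (fun t h1 h2 h3 => SomborAux.deg_bound G v u y hvpath t h1 h2 h3) hz1 hwz hw ?_ ?_ ?_
  · intro a b ha hb hab
    rw [hadj, hG']
    refine Or.inl ⟨hab, ?_⟩
    simp only [Set.mem_union, Set.mem_insert_iff, Set.mem_singleton_iff, Set.mem_setOf_eq,
      Sym2.eq_iff]
    grind
  · intro b hb hab
    rw [hadj, hG']
    have hb' : b ∈ G.neighborSet v := hab
    rw [hW] at hb'
    rcases hb' with (rfl | rfl) | ⟨j, rfl⟩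
    · exact absurd rfl hb
    · exact Or.inr (Or.inl (Or.inl rfl))
    · exact Or.inr (Or.inl (Or.inr ⟨j, rfl⟩))
  · rw [hadj, hG']
    exact Or.inr (Or.inr rfl)
end
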